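/- arXiv:2402.15661 — 2 statements merged into one kernel-verified Lean document; each statement's English description precedes it below -/
import Mathlib

section
/- Let X be a separable real Banach space whose dual X* has Property(M*). If X is not reflexive, then X contains an asymptotically isometric copy of c₀, X fails the fixed point property, X* contains an asymptotically isometric copy of ℓ₁, and X* fails the fixed point property. -/
open Filter Topology ZeroAtInfty

/-- A sequence converges weakly to zero. -/
def WeakNull {E : Type*} [NormedAddCommGroup E] [NormedSpace ℝ E] (x : ℕ → E) : Prop :=
  ∀ f : E →L[ℝ] ℝ, Tendsto (fun n => f (x n)) atTop (nhds 0)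

/-- Property (M). -/
def PropertyM (E : Type*) [NormedAddCommGroup E] [NormedSpace ℝ E] : Prop :=
  ∀ x : ℕ → E, WeakNull x → ∀ u v : E, ‖u‖ ≤ ‖v‖ →
    Filter.limsup (fun n => ‖x n + u‖) atTop ≤ Filter.limsup (fun n => ‖x n + v‖) atTop

/-- `F` embeds isomorphically into `E`. -/
def EmbedsIso (F E : Type*) [NormedAddCommGroup F] [NormedSpace ℝ F]
    [NormedAddCommGroup E] [NormedSpace ℝ E] : Prop :=
  ∃ T : F →L[ℝ] E, Function.Injective T ∧ ∃ c > (0 : ℝ), ∀ y, c * ‖y‖ ≤ ‖T y‖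

/-- Weak normal structure. -/
def WeakNormalStructure (E : Type*) [NormedAddCommGroup E] [NormedSpace ℝ E] : Prop :=
  ∀ C : Set E, Convex ℝ C → IsCompact (toWeakSpace ℝ E '' C) → C.Nontrivial →
    ∃ x ∈ C, sSup ((fun y => ‖x - y‖) '' C) < Metric.diam C

/-- Property (K). -/
def PropertyK (E : Type*) [NormedAddCommGroup E] [NormedSpace ℝ E] : Prop :=
  ∃ K : ℝ, 0 ≤ K ∧ K < 1 ∧ ∀ (x : ℕ → E) (y : E), WeakNull x →
    Tendsto (fun n => ‖x n‖) atTop (nhds 1) →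
    Filter.liminf (fun n => ‖x n - y‖) atTop ≤ 1 → ‖y‖ ≤ K

/-- Kadec-Klee norm. -/
def KadecKlee (E : Type*) [NormedAddCommGroup E] [NormedSpace ℝ E] : Prop :=
  ∀ (x : ℕ → E) (y : E),
    (∀ f : E →L[ℝ] ℝ, Tendsto (fun n => f (x n)) atTop (nhds (f y))) →
    Tendsto (fun n => ‖x n‖) atTop (nhds ‖y‖) →
    Tendsto (fun n => ‖x n - y‖) atTop (nhds 0)

/-- Opial's modulus. -/
noncomputable def opialModulus (E : Type*) [NormedAddCommGroup E] [NormedSpace ℝ E]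
    (c : ℝ) : ℝ :=
  sInf { r : ℝ | ∃ (x : ℕ → E) (y : E), c ≤ ‖y‖ ∧ WeakNull x ∧
    1 ≤ Filter.liminf (fun n => ‖x n‖) atTop ∧
    r = Filter.liminf (fun n => ‖x n - y‖) atTop - 1 }

/-- A sequence of functionals converges weak-star to zero. -/
def WeakStarNull {E : Type*} [NormedAddCommGroup E] [NormedSpace ℝ E]
    (f : ℕ → (E →L[ℝ] ℝ)) : Prop :=
  ∀ x : E, Tendsto (fun n => f n x) atTop (nhds 0)

/-- Property (M*) of the dual. -/
def PropertyMStar (E : Type*) [NormedAddCommGroup E] [NormedSpace ℝ E] : Prop :=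
  ∀ f : ℕ → (E →L[ℝ] ℝ), WeakStarNull f → ∀ u v : E →L[ℝ] ℝ, ‖u‖ ≤ ‖v‖ →
    Filter.limsup (fun n => ‖f n + u‖) atTop ≤ Filter.limsup (fun n => ‖f n + v‖) atTop

/-- Property (K*) of the dual. -/
def PropertyKStar (E : Type*) [NormedAddCommGroup E] [NormedSpace ℝ E] : Prop :=
  ∃ K : ℝ, 0 ≤ K ∧ K < 1 ∧ ∀ (f : ℕ → (E →L[ℝ] ℝ)) (g : E →L[ℝ] ℝ), WeakStarNull f →
    Tendsto (fun n => ‖f n‖) atTop (nhds 1) →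
    Filter.liminf (fun n => ‖f n - g‖) atTop ≤ 1 → ‖g‖ ≤ K

/-- weak* Kadec-Klee norm on the dual. -/
def WeakStarKadecKlee (E : Type*) [NormedAddCommGroup E] [NormedSpace ℝ E] : Prop :=
  ∀ (f : ℕ → (E →L[ℝ] ℝ)) (g : E →L[ℝ] ℝ),
    (∀ x : E, Tendsto (fun n => f n x) atTop (nhds (g x))) →
    Tendsto (fun n => ‖f n‖) atTop (nhds ‖g‖) →
    Tendsto (fun n => ‖f n - g‖) atTop (nhds 0)

/-- weak* Opial modulus of the dual. -/
noncomputable def weakStarOpialModulus (E : Type*) [NormedAddCommGroup E] [NormedSpace ℝ E]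
    (c : ℝ) : ℝ :=
  sInf { r : ℝ | ∃ (f : ℕ → (E →L[ℝ] ℝ)) (g : E →L[ℝ] ℝ), c ≤ ‖g‖ ∧ WeakStarNull f ∧
    1 ≤ Filter.liminf (fun n => ‖f n‖) atTop ∧
    r = Filter.liminf (fun n => ‖f n - g‖) atTop - 1 }

/-- WORTH* for the dual. -/
def WORTHStar (E : Type*) [NormedAddCommGroup E] [NormedSpace ℝ E] : Prop :=
  ∀ f : ℕ → (E →L[ℝ] ℝ), WeakStarNull f → ∀ g : E →L[ℝ] ℝ,
    Tendsto (fun n => ‖f n - g‖ - ‖f n + g‖) atTop (nhds 0)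

/-- Reflexivity of a normed space. -/
def IsReflexive (E : Type*) [NormedAddCommGroup E] [NormedSpace ℝ E] : Prop :=
  Function.Surjective (NormedSpace.inclusionInDoubleDual ℝ E)

/-- The fixed point property for nonexpansive maps. -/
def FPP (E : Type*) [NormedAddCommGroup E] [NormedSpace ℝ E] : Prop :=
  ∀ C : Set E, C.Nonempty → IsClosed C → Bornology.IsBounded C → Convex ℝ C →
    ∀ T : E → E, Set.MapsTo T C C →
      (∀ x ∈ C, ∀ y ∈ C, ‖T x - T y‖ ≤ ‖x - y‖) → ∃ x ∈ C, T x = x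

/-- `E` contains an asymptotically isometric copy of `c₀`. -/
def ContainsAsympIsoC0 (E : Type*) [NormedAddCommGroup E] [NormedSpace ℝ E] : Prop :=
  ∃ ε : ℕ → ℝ, (∀ n, ε n ∈ Set.Ioo (0 : ℝ) 1) ∧ Tendsto ε atTop (nhds 0) ∧
    ∃ x : ℕ → E, ∀ t : ℕ →₀ ℝ,
      (∀ n, (1 - ε n) * |t n| ≤ ‖∑ n ∈ t.support, t n • x n‖) ∧
      ‖∑ n ∈ t.support, t n • x n‖ ≤ ⨆ n, |t n|

/-- `E` contains an asymptotically isometric copy of `ℓ₁`. -/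
def ContainsAsympIsoL1 (E : Type*) [NormedAddCommGroup E] [NormedSpace ℝ E] : Prop :=
  ∃ ε : ℕ → ℝ, (∀ n, ε n ∈ Set.Ioo (0 : ℝ) 1) ∧ Tendsto ε atTop (nhds 0) ∧
    ∃ x : ℕ → E, ∀ t : ℕ →₀ ℝ,
      (∑ n ∈ t.support, (1 - ε n) * |t n| ≤ ‖∑ n ∈ t.support, t n • x n‖) ∧
      ‖∑ n ∈ t.support, t n • x n‖ ≤ ∑ n ∈ t.support, |t n|


section Bidual

variable {E : Type*} [NormedAddCommGroup E] [NormedSpace ℝ E]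

theorem exists_norm_lt_apply_eq (φ : E →L[ℝ] ℝ) {v r s : ℝ} (hr : 0 ≤ r) (hrs : r < s)
    (hv : |v| ≤ r * ‖φ‖) : ∃ b : E, ‖b‖ < s ∧ φ b = v := by
  rcases eq_or_ne v 0 with rfl | hv0
  · exact ⟨0, by simpa using hr.trans_lt hrs, by simp⟩
  have hpos : 0 < |v| := abs_pos.2 hv0
  have hs : 0 < s := hr.trans_lt hrs
  have hφ : 0 < ‖φ‖ := by
    by_contra h
    have : ‖φ‖ = 0 := le_antisymm (not_lt.1 h) (norm_nonneg _)
    rw [this, mul_zero] at hv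
    linarith
  have hlt : |v| / s < ‖φ‖ := by
    rw [div_lt_iff₀ hs]
    nlinarith
  obtain ⟨x, hx1, hx⟩ := φ.exists_lt_apply_of_lt_opNorm hlt
  rw [Real.norm_eq_abs] at hx
  have hxpos : 0 < |φ x| := lt_of_le_of_lt (by positivity) hx
  refine ⟨(v / φ x) • x, ?_, ?_⟩
  · rw [norm_smul, norm_div, Real.norm_eq_abs, Real.norm_eq_abs]
    rw [div_lt_iff₀ hs] at hx
    calc |v| / |φ x| * ‖x‖ ≤ |v| / |φ x| * 1 := by gcongr
      _ = |v| / |φ x| := mul_one _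
      _ < s := by rw [div_lt_iff₀ hxpos]; linarith
  · rw [map_smul, smul_eq_mul, div_mul_cancel₀ _ (abs_pos.1 hxpos)]

theorem exists_apply_gt_of_lt_norm (φ : E →L[ℝ] ℝ) {r : ℝ} (hr : r < ‖φ‖) :
    ∃ b : E, ‖b‖ ≤ 1 ∧ r < φ b := by
  obtain ⟨x, hx1, hx⟩ := φ.exists_lt_apply_of_lt_opNorm hr
  rcases le_total 0 (φ x) with h | h
  · exact ⟨x, hx1.le, by rwa [Real.norm_of_nonneg h] at hx⟩
  · exact ⟨-x, by simpa using hx1.le, by rwa [Real.norm_of_nonpos h, ← map_neg] at hx⟩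

theorem eq_zero_of_bddBelow {F : Type*} [AddCommGroup F] [Module ℝ F] (M : F →ₗ[ℝ] ℝ) {c : ℝ}
    (h : ∀ z, c ≤ M z) (z : F) : M z = 0 := by
  by_contra hz
  have := h (((c - 1) / M z) • z)
  rw [map_smul, smul_eq_mul, div_mul_cancel₀ _ hz] at this
  linarith

theorem pi_dual_apply {ι F : Type*} [Fintype ι] [DecidableEq ι] [NormedAddCommGroup F]
    [NormedSpace ℝ F] (L : (ι → F) →L[ℝ] ℝ) (b : ι → F) :
    L b = ∑ i, (L.comp (ContinuousLinearMap.single ℝ (fun _ : ι => F) i)) (b i) := by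
  conv_lhs => rw [← Finset.univ_sum_single b]
  rw [map_sum]
  rfl

/-- A form of the principle of local reflexivity: finitely many norm bounds on translates of an
element of the bidual are realized in the space, along with finitely many approximate values. -/
theorem exists_approx_of_bidual {ι κ : Type*} [Fintype ι] [Fintype κ] (x : ι → E)
    (ζ : StrongDual ℝ (StrongDual ℝ E)) (r : ι → ℝ)
    (hr : ∀ i, ‖NormedSpace.inclusionInDoubleDual ℝ E (x i) + ζ‖ < r i)
    (h : κ → StrongDual ℝ E) {η : ℝ} (hη : 0 < η) :
    ∃ z : E, (∀ i, ‖x i + z‖ < r i) ∧ ∀ j, |h j z - ζ (h j)| < η := by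
  classical
  let U : Set ((ι → E) × (κ → ℝ)) :=
    (Set.univ.pi fun i => Metric.ball 0 (r i)) ×ˢ (Set.univ.pi fun j => Metric.ball (ζ (h j)) η)
  let S : Set ((ι → E) × (κ → ℝ)) := Set.range fun z : E => (fun i => x i + z, fun j => h j z)
  have hUc : Convex ℝ U := by
    refine Convex.prod (convex_pi fun i _ => ?_) (convex_pi fun j _ => ?_)
    · exact convex_ball 0 (r i)
    · exact convex_ball (ζ (h j)) η
  have hUo : IsOpen U :=
    (isOpen_set_pi Set.finite_univ fun i _ => Metric.isOpen_ball).prod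
      (isOpen_set_pi Set.finite_univ fun j _ => Metric.isOpen_ball)
  have hSc : Convex ℝ S := by
    rintro _ ⟨z, rfl⟩ _ ⟨w, rfl⟩ a b ha hb hab
    refine ⟨a • z + b • w, ?_⟩
    ext i
    · have : x i = a • x i + b • x i := by rw [← add_smul, hab, one_smul]
      simp only [Prod.smul_mk, Prod.mk_add_mk, Pi.add_apply, Pi.smul_apply, smul_add]
      nth_rewrite 1 [this]
      abel
    · simp
  by_contra hcon
  have hdisj : Disjoint U S := by
    rw [Set.disjoint_right]
    rintro _ ⟨z, rfl⟩ ⟨hz1, hz2⟩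
    refine hcon ⟨z, fun i => ?_, fun j => ?_⟩
    · simpa using hz1 i (Set.mem_univ i)
    · simpa [Real.dist_eq] using hz2 j (Set.mem_univ j)
  obtain ⟨L, s, hLU, hLS⟩ := geometric_hahn_banach_open hUc hUo hSc hdisj
  let L₁ := L.comp (ContinuousLinearMap.inl ℝ (ι → E) (κ → ℝ))
  let L₂ := L.comp (ContinuousLinearMap.inr ℝ (ι → E) (κ → ℝ))
  let f : ι → StrongDual ℝ E := fun i =>
    L₁.comp (ContinuousLinearMap.single ℝ (fun _ : ι => E) i)
  let l : κ → ℝ := fun j => (L₂.comp (ContinuousLinearMap.single ℝ (fun _ : κ => ℝ) j)) 1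
  have hL : ∀ b c, L (b, c) = ∑ i, f i (b i) + ∑ j, c j * l j := by
    intro b c
    have h1 : L (b, c) = L₁ b + L₂ c := by simp [L₁, L₂, ← map_add]
    rw [h1, pi_dual_apply L₁ b, pi_dual_apply L₂ c]
    congr 1
    refine Finset.sum_congr rfl fun j _ => ?_
    rw [← smul_eq_mul (c j), ← map_smul, smul_eq_mul, mul_one]
  let M : StrongDual ℝ E := ∑ i, f i + ∑ j, l j • h j
  have hM : ∀ z, s - ∑ i, f i (x i) ≤ M z := by
    intro z
    have := hLS _ ⟨z, rfl⟩
    rw [hL] at this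
    simp only [map_add, Finset.sum_add_distrib] at this
    simp only [M, add_apply, sum_apply, smul_apply,
      smul_eq_mul, mul_comm (l _)]
    linarith
  have hM0 : M = 0 := by
    ext z
    exact eq_zero_of_bddBelow M.toLinearMap hM z
  have hb : ∀ i, ∃ b : E, ‖b‖ < r i ∧ f i b =
      (NormedSpace.inclusionInDoubleDual ℝ E (x i) + ζ) (f i) := fun i =>
    exists_norm_lt_apply_eq (f i) (norm_nonneg _) (hr i)
      ((NormedSpace.inclusionInDoubleDual ℝ E (x i) + ζ).le_opNorm (f i))
  choose b hbn hbv using hb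
  have h1 : L (b, fun j => ζ (h j)) < s := by
    refine hLU _ ⟨fun i _ => by simpa using hbn i, fun j _ => by simpa using hη⟩
  have h2 : ζ M = ∑ i, ζ (f i) + ∑ j, ζ (h j) * l j := by
    simp [M, map_add, map_sum, mul_comm]
  rw [hL] at h1
  simp only [hbv, add_apply, NormedSpace.dual_def, Finset.sum_add_distrib] at h1
  have h3 := hM 0
  rw [map_zero] at h3
  rw [hM0, map_zero] at h2
  linarith

end Bidual

section MIdeal

set_option maxSynthPendingDepth 6

variable {X : Type*} [NormedAddCommGroup X] [NormedSpace ℝ X]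

theorem PropertyMStar.eventually_norm_add_lt (hM : PropertyMStar X) {g : ℕ → (X →L[ℝ] ℝ)}
    (hg : WeakStarNull g) {u v : X →L[ℝ] ℝ} (huv : ‖u‖ ≤ ‖v‖) {c d : ℝ} (hcd : c < d)
    (hv : ∀ᶠ n in atTop, ‖g n + v‖ ≤ c) : ∀ᶠ n in atTop, ‖g n + u‖ < d := by
  refine eventually_lt_of_limsup_lt ?_ ?_
  · refine ((hM g hg u v huv).trans (limsup_le_of_le ?_ hv)).trans_lt hcd
    exact isCoboundedUnder_le_of_le atTop (x := 0) fun n => norm_nonneg _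
  · refine isBoundedUnder_of_eventually_le (a := c + ‖v - u‖) ?_
    filter_upwards [hv] with n hn
    calc ‖g n + u‖ = ‖(g n + v) - (v - u)‖ := by congr 1; abel
      _ ≤ ‖g n + v‖ + ‖v - u‖ := norm_sub_le _ _
      _ ≤ c + ‖v - u‖ := by linarith

theorem weakStarNull_of_denseRange {g : ℕ → (X →L[ℝ] ℝ)} {C : ℝ} (hC : ∀ n, ‖g n‖ ≤ C)
    {d : ℕ → X} (hd : DenseRange d) (h : ∀ k, Tendsto (fun n => g n (d k)) atTop (nhds 0)) :
    WeakStarNull g := by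
  intro x
  have hC0 : 0 ≤ C := (norm_nonneg _).trans (hC 0)
  rw [Metric.tendsto_atTop]
  intro ε hε
  obtain ⟨k, hk⟩ := hd.exists_dist_lt x (show 0 < ε / (2 * (C + 1)) by positivity)
  obtain ⟨N, hN⟩ := (Metric.tendsto_atTop.1 (h k)) (ε / 2) (by positivity)
  refine ⟨N, fun n hn => ?_⟩
  have h1 := hN n hn
  rw [dist_zero_right] at h1 ⊢
  rw [dist_eq_norm] at hk
  have h2 : ‖g n (x - d k)‖ ≤ C * (ε / (2 * (C + 1))) :=
    (g n).le_of_opNorm_le_of_le (hC n) hk.le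
  have h3 : C * (ε / (2 * (C + 1))) ≤ ε / 2 := by
    rw [mul_div_assoc', div_le_div_iff₀ (by positivity) (by positivity)]
    nlinarith
  calc ‖g n x‖ = ‖g n (x - d k) + g n (d k)‖ := by rw [← map_add, sub_add_cancel]
    _ ≤ ‖g n (x - d k)‖ + ‖g n (d k)‖ := norm_add_le _ _
    _ < ε := by linarith

/-- Under property `(M*)`, the third dual norm is additive along `X*** = X* ⊕ Xᗮ`. -/
theorem PropertyMStar.norm_restrict_add_le (hM : PropertyMStar X)
    [TopologicalSpace.SeparableSpace X] {ξ : StrongDual ℝ (StrongDual ℝ X)} (hξ : ‖ξ‖ = 1)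
    (φ : StrongDual ℝ (StrongDual ℝ (StrongDual ℝ X))) :
    ‖φ.comp (NormedSpace.inclusionInDoubleDual ℝ X)‖ +
      |φ ξ - ξ (φ.comp (NormedSpace.inclusionInDoubleDual ℝ X))| ≤ ‖φ‖ := by
  set J := NormedSpace.inclusionInDoubleDual ℝ X
  set f : StrongDual ℝ X := φ.comp J with hf
  obtain ⟨d, hd⟩ := TopologicalSpace.exists_dense_seq X
  have hex : ∀ n : ℕ, ∃ e : StrongDual ℝ X, ‖e‖ < ‖φ‖ + 1 / ((n : ℝ) + 1) ∧
      |ξ e - φ ξ| < 1 / ((n : ℝ) + 1) ∧ ∀ k ≤ n, |e (d k) - f (d k)| < 1 / ((n : ℝ) + 1) := by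
    intro n
    have hpos : 0 < 1 / ((n : ℝ) + 1) := by positivity
    obtain ⟨z, hz1, hz2⟩ := exists_approx_of_bidual (ι := Unit) (κ := Option (Fin (n + 1)))
      (fun _ => (0 : StrongDual ℝ X)) φ (fun _ => ‖φ‖ + 1 / ((n : ℝ) + 1))
      (fun _ => by simpa using hpos)
      (fun o => o.elim ξ fun k => J (d k)) hpos
    refine ⟨z, by simpa using hz1 (), hz2 none, fun k hk => ?_⟩
    exact hz2 (some ⟨k, Nat.lt_succ_of_le hk⟩)
  choose e he1 he2 he3 using hex
  have hlim : Tendsto (fun n : ℕ => 1 / ((n : ℝ) + 1)) atTop (nhds 0) :=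
    tendsto_one_div_add_atTop_nhds_zero_nat
  have hone : ∀ n : ℕ, 1 / ((n : ℝ) + 1) ≤ 1 := fun n => by
    rw [div_le_one (by positivity)]
    linarith [(Nat.cast_nonneg n : (0 : ℝ) ≤ n)]
  let g : ℕ → StrongDual ℝ X := fun n => e n - f
  have hg : WeakStarNull g := by
    refine weakStarNull_of_denseRange (C := ‖φ‖ + 1 + ‖f‖) (fun n => ?_) hd fun k => ?_
    · refine (norm_sub_le _ _).trans ?_
      linarith [he1 n, hone n]
    · refine squeeze_zero_norm' ?_ hlim
      filter_upwards [eventually_ge_atTop k] with n hn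
      exact (he3 n k hn).le
  have hξg : Tendsto (fun n => ξ (g n)) atTop (nhds (φ ξ - ξ f)) := by
    have : Tendsto (fun n => ξ (e n)) atTop (nhds (φ ξ)) := by
      rw [tendsto_iff_norm_sub_tendsto_zero]
      exact squeeze_zero (fun n => norm_nonneg _) (fun n => (he2 n).le) hlim
    simpa [g] using this.sub_const (ξ f)
  refine le_of_forall_pos_le_add fun ε hε => ?_
  obtain ⟨u₀, hu₀, hξu₀⟩ : ∃ u : StrongDual ℝ X, ‖u‖ ≤ ‖f‖ ∧ ‖f‖ - ε / 4 ≤ ξ u := by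
    have hlt : 1 - ε / (4 * (‖f‖ + 1)) < ‖ξ‖ := by
      rw [hξ]
      have : 0 < ε / (4 * (‖f‖ + 1)) := by positivity
      linarith
    obtain ⟨b, hb, hξb⟩ := exists_apply_gt_of_lt_norm ξ hlt
    refine ⟨‖f‖ • b, ?_, ?_⟩
    · rw [norm_smul, norm_norm]
      exact mul_le_of_le_one_right (norm_nonneg _) hb
    · have h3 : ‖f‖ * (ε / (4 * (‖f‖ + 1))) ≤ ε / 4 := by
        rw [mul_div_assoc', div_le_div_iff₀ (by positivity) (by positivity)]
        nlinarith [norm_nonneg f]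
      rw [map_smul, smul_eq_mul]
      nlinarith [norm_nonneg f]
  obtain ⟨σ, hσ, hσa⟩ : ∃ σ : ℝ, |σ| = 1 ∧ |φ ξ - ξ f| = σ * (φ ξ - ξ f) := by
    rcases le_total 0 (φ ξ - ξ f) with h | h
    · exact ⟨1, by simp, by rw [abs_of_nonneg h, one_mul]⟩
    · exact ⟨-1, by simp, by rw [abs_of_nonpos h]; ring⟩
  have hσσ : σ * σ = 1 := by
    rw [← abs_mul_abs_self, hσ, one_mul]
  have hev : ∀ᶠ n in atTop, ‖g n + σ • u₀‖ < ‖φ‖ + ε / 2 := by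
    refine hM.eventually_norm_add_lt hg (v := f) (c := ‖φ‖ + ε / 4) ?_ (by linarith) ?_
    · rwa [norm_smul, Real.norm_eq_abs, hσ, one_mul]
    · filter_upwards [hlim.eventually (gt_mem_nhds (show 0 < ε / 4 by positivity))] with n hn
      have : g n + f = e n := sub_add_cancel _ _
      rw [this]
      linarith [he1 n]
  have hev2 : ∀ᶠ n in atTop, σ * (φ ξ - ξ f) - ε / 4 < σ * ξ (g n) :=
    (hξg.const_mul σ).eventually (lt_mem_nhds (by linarith))
  obtain ⟨n, hn1, hn2⟩ := (hev.and hev2).exists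
  have hub : σ * ξ (g n + σ • u₀) ≤ ‖g n + σ • u₀‖ := by
    refine (le_abs_self _).trans ?_
    rw [abs_mul, hσ, one_mul]
    simpa [hξ] using ξ.le_opNorm (g n + σ • u₀)
  have hexp : σ * ξ (g n + σ • u₀) = σ * ξ (g n) + ξ u₀ := by
    rw [map_add, map_smul, smul_eq_mul, mul_add, ← mul_assoc, hσσ, one_mul]
  rw [hσa]
  linarith

/-- The intersection property of balls which characterizes `M`-ideals in the bidual. -/
theorem PropertyMStar.exists_norm_add_sub_lt (hM : PropertyMStar X)
    [TopologicalSpace.SeparableSpace X] {ξ : StrongDual ℝ (StrongDual ℝ X)} (hξ : ‖ξ‖ = 1)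
    {ι : Type*} [Fintype ι] (x : ι → X) (hx : ∀ i, ‖x i‖ ≤ 1) {ε : ℝ} (hε : 0 < ε) :
    ∃ y : X, ∀ i, ‖NormedSpace.inclusionInDoubleDual ℝ X (x i) +
      (ξ - NormedSpace.inclusionInDoubleDual ℝ X y)‖ < 1 + ε := by
  classical
  set J := NormedSpace.inclusionInDoubleDual ℝ X
  let U : Set (ι → StrongDual ℝ (StrongDual ℝ X)) := Set.univ.pi fun _ => Metric.ball 0 (1 + ε)
  let S : Set (ι → StrongDual ℝ (StrongDual ℝ X)) :=
    Set.range fun y : X => fun i => J (x i) + (ξ - J y)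
  have hUc : Convex ℝ U := convex_pi fun i _ => convex_ball 0 (1 + ε)
  have hUo : IsOpen U := isOpen_set_pi Set.finite_univ fun i _ => Metric.isOpen_ball
  have hSc : Convex ℝ S := by
    rintro _ ⟨z, rfl⟩ _ ⟨w, rfl⟩ a b ha hb hab
    refine ⟨a • z + b • w, ?_⟩
    funext i
    have : J (x i) + ξ = a • (J (x i) + ξ) + b • (J (x i) + ξ) := by
      rw [← add_smul, hab, one_smul]
    simp only [Pi.add_apply, Pi.smul_apply, map_add, map_smul]
    rw [← add_sub_assoc, this]
    module
  by_contra hcon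
  have hdisj : Disjoint U S := by
    rw [Set.disjoint_right]
    rintro _ ⟨y, rfl⟩ hy
    exact hcon ⟨y, fun i => by simpa using hy i (Set.mem_univ i)⟩
  obtain ⟨L, s, hLU, hLS⟩ := geometric_hahn_banach_open hUc hUo hSc hdisj
  let φ : ι → StrongDual ℝ (StrongDual ℝ (StrongDual ℝ X)) := fun i =>
    L.comp (ContinuousLinearMap.single ℝ (fun _ : ι => StrongDual ℝ (StrongDual ℝ X)) i)
  have hL : ∀ b, L b = ∑ i, φ i (b i) := fun b => pi_dual_apply L b
  let F : StrongDual ℝ X := ∑ i, (φ i).comp J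
  have hFb : ∀ y, s - ∑ i, φ i (J (x i) + ξ) ≤ F y := by
    intro y
    have := hLS _ ⟨-y, rfl⟩
    rw [hL] at this
    simp only [map_neg, sub_neg_eq_add, map_add, Finset.sum_add_distrib] at this ⊢
    simp only [F, sum_apply, ContinuousLinearMap.comp_apply]
    linarith
  have hF0 : F = 0 := by
    ext y
    exact eq_zero_of_bddBelow F.toLinearMap hFb y
  have hs : s ≤ ∑ i, φ i (J (x i) + ξ) := by
    have := hFb 0
    rw [map_zero] at this
    linarith
  have hb : ∀ i, ∃ b, ‖b‖ < 1 + ε ∧ φ i b = ‖φ i‖ := fun i =>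
    exists_norm_lt_apply_eq (φ i) (r := 1) zero_le_one (by linarith)
      (by rw [abs_of_nonneg (norm_nonneg _), one_mul])
  choose b hbn hbv using hb
  have h1 : L b < s := hLU _ fun i _ => by simpa using hbn i
  rw [hL] at h1
  simp only [hbv] at h1
  have h2 : ∑ i, φ i (J (x i) + ξ) ≤ ∑ i, ‖φ i‖ + ξ F := by
    simp only [F, map_sum, ← Finset.sum_add_distrib]
    refine Finset.sum_le_sum fun i _ => ?_
    have h3 := hM.norm_restrict_add_le hξ (φ i)
    have h4 : φ i (J (x i)) ≤ ‖(φ i).comp J‖ := by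
      have := ((φ i).comp J).le_opNorm (x i)
      refine (le_abs_self _).trans (this.trans ?_)
      exact mul_le_of_le_one_right (norm_nonneg _) (hx i)
    have h5 := le_abs_self (φ i ξ - ξ ((φ i).comp J))
    rw [map_add]
    linarith
  rw [hF0, map_zero] at h2
  linarith

theorem exists_norm_eq_one_forall_le_norm_sub [CompleteSpace X] (hr : ¬ IsReflexive X) {δ : ℝ}
    (hδ : 0 < δ) : ∃ ξ : StrongDual ℝ (StrongDual ℝ X), ‖ξ‖ = 1 ∧
      ∀ y, 1 - δ ≤ ‖ξ - NormedSpace.inclusionInDoubleDual ℝ X y‖ := by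
  set J := NormedSpace.inclusionInDoubleDual ℝ X
  have hcl : IsClosed (LinearMap.range J.toLinearMap : Set (StrongDual ℝ (StrongDual ℝ X))) :=
    (NormedSpace.inclusionInDoubleDualLi (E := X)
      ℝ).isometry.isUniformInducing.isComplete_range.isClosed
  have hne : ∃ ξ, ξ ∉ LinearMap.range J.toLinearMap := by
    by_contra! h
    exact hr h
  obtain ⟨ξ, hξ, h⟩ := riesz_lemma hcl hne (show 1 - δ < 1 by linarith)
  have hξ0 : 0 < ‖ξ‖ := norm_pos_iff.2 fun h0 => hξ (h0 ▸ Submodule.zero_mem _)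
  refine ⟨‖ξ‖⁻¹ • ξ, ?_, fun y => ?_⟩
  · rw [norm_smul, norm_inv, norm_norm, inv_mul_cancel₀ hξ0.ne']
  · have h1 := h (J (‖ξ‖ • y)) ⟨_, rfl⟩
    have h2 : ‖ξ‖⁻¹ • ξ - J y = ‖ξ‖⁻¹ • (ξ - J (‖ξ‖ • y)) := by
      rw [map_smul, smul_sub, smul_smul, inv_mul_cancel₀ hξ0.ne', one_smul]
    rw [h2, norm_smul, norm_inv, norm_norm, ← div_eq_inv_mul, le_div_iff₀ hξ0]
    exact h1

theorem PropertyMStar.exists_norm_add_lt (hM : PropertyMStar X) [CompleteSpace X]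
    [TopologicalSpace.SeparableSpace X] (hr : ¬ IsReflexive X) {ι : Type*} [Fintype ι]
    (x : ι → X) (hx : ∀ i, ‖x i‖ ≤ 1) {ε : ℝ} (hε : 0 < ε) :
    ∃ z : X, 1 - ε ≤ ‖z‖ ∧ ∀ i, ‖x i + z‖ < 1 + ε := by
  obtain ⟨ξ, hξ, hdist⟩ := exists_norm_eq_one_forall_le_norm_sub hr (show 0 < ε / 3 by positivity)
  obtain ⟨y, hy⟩ := hM.exists_norm_add_sub_lt hξ x hx hε
  set ζ := ξ - NormedSpace.inclusionInDoubleDual ℝ X y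
  obtain ⟨h, hh, hζh⟩ := exists_apply_gt_of_lt_norm ζ
    (show 1 - 2 * (ε / 3) < ‖ζ‖ by linarith [hdist y])
  obtain ⟨z, hz1, hz2⟩ := exists_approx_of_bidual (κ := Unit) x ζ (fun _ => 1 + ε) hy (fun _ => h)
    (show 0 < ε / 3 by positivity)
  refine ⟨z, ?_, hz1⟩
  have h1 := (abs_lt.1 (hz2 ())).1
  have h2 : h z ≤ ‖z‖ := (le_abs_self _).trans (by simpa using h.le_of_opNorm_le hh z)
  linarith

end MIdeal

section Sequences

variable {X : Type*} [NormedAddCommGroup X] [NormedSpace ℝ X]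

theorem PropertyMStar.exists_norm_add_sub_le (hM : PropertyMStar X) [CompleteSpace X]
    [TopologicalSpace.SeparableSpace X] (hr : ¬ IsReflexive X) {c ε : ℝ} (hc : 0 < c)
    (hc1 : c ≤ 1) (hε : 0 < ε) (A : Finset X) (hA : ∀ a ∈ A, ‖a‖ ≤ c) :
    ∃ z : X, c - ε ≤ ‖z‖ ∧ ∀ a ∈ A, ‖a + z‖ ≤ c + ε ∧ ‖a - z‖ ≤ c + ε := by
  obtain ⟨z, hz, hzA⟩ := hM.exists_norm_add_lt hr (ι := A ⊕ A)
    (Sum.elim (fun a => c⁻¹ • (a : X)) fun a => -(c⁻¹ • (a : X))) (by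
      have : ∀ a : A, ‖c⁻¹ • (a : X)‖ ≤ 1 := fun a => by
        rw [norm_smul, norm_inv, Real.norm_of_nonneg hc.le, ← div_eq_inv_mul, div_le_one hc]
        exact hA a a.2
      rintro (a | a)
      · exact this a
      · simpa only [Sum.elim_inr, norm_neg] using this a) hε
  have hscale : ∀ v w : X, c⁻¹ • v + z = w → ‖w‖ < 1 + ε → ‖v + c • z‖ ≤ c + ε := by
    rintro v _ rfl hw
    have : v + c • z = c • (c⁻¹ • v + z) := by
      rw [smul_add, smul_smul, mul_inv_cancel₀ hc.ne', one_smul]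
    rw [this, norm_smul, Real.norm_of_nonneg hc.le]
    nlinarith
  refine ⟨c • z, ?_, fun a ha => ⟨?_, ?_⟩⟩
  · rw [norm_smul, Real.norm_of_nonneg hc.le]
    nlinarith
  · exact hscale a _ rfl (hzA (Sum.inl ⟨a, ha⟩))
  · have := hscale (-a) _ (by rw [smul_neg]; rfl) (hzA (Sum.inr ⟨a, ha⟩))
    rwa [← norm_neg, neg_sub, sub_eq_neg_add]

/-- The normalized weakly unconditionally Cauchy sequence underlying the copies of `c₀`
and `ℓ₁`. -/
theorem PropertyMStar.exists_wuc_seq (hM : PropertyMStar X) [CompleteSpace X]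
    [TopologicalSpace.SeparableSpace X] (hr : ¬ IsReflexive X) :
    ∃ x : ℕ → X, (∀ (g : X →L[ℝ] ℝ) (F : Finset ℕ), ∑ k ∈ F, |g (x k)| ≤ ‖g‖) ∧
      ∀ n, 1 - (1 / 2 : ℝ) ^ n / 32 ≤ ‖x n‖ := by
  classical
  let c : ℕ → ℝ := fun n => 1 - (1 / 2 : ℝ) ^ n / 64
  have hpow : ∀ n : ℕ, 0 < (1 / 2 : ℝ) ^ n ∧ (1 / 2 : ℝ) ^ n ≤ 1 := fun n =>
    ⟨by positivity, pow_le_one₀ (by norm_num) (by norm_num)⟩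
  have hstep : ∀ (n : ℕ) (A : Finset X), (∀ a ∈ A, ‖a‖ ≤ c n) → ∃ z : X,
      1 - (1 / 2 : ℝ) ^ n / 32 ≤ ‖z‖ ∧ ∀ a ∈ A, ‖a + z‖ ≤ c (n + 1) ∧ ‖a - z‖ ≤ c (n + 1) := by
    intro n A hA
    obtain ⟨h0, h1⟩ := hpow n
    obtain ⟨z, hz, hzA⟩ := hM.exists_norm_add_sub_le hr (c := c n)
      (ε := (1 / 2 : ℝ) ^ n / 128) (by simp only [c]; linarith) (by simp only [c]; linarith)
      (by positivity) A hA
    have hc : c n + (1 / 2 : ℝ) ^ n / 128 = c (n + 1) := by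
      simp only [c, pow_succ]
      ring
    rw [hc] at hzA
    refine ⟨z, le_trans ?_ hz, hzA⟩
    simp only [c]
    linarith
  choose! f hf1 hf2 using hstep
  let A : ℕ → Finset X := fun n => Nat.rec {0}
    (fun n B => B.image (· + f n B) ∪ B.image (· - f n B)) n
  have hAs : ∀ n, A (n + 1) = (A n).image (· + f n (A n)) ∪ (A n).image (· - f n (A n)) :=
    fun n => rfl
  have hA : ∀ n, ∀ a ∈ A n, ‖a‖ ≤ c n := by
    intro n
    induction n with
    | zero =>
      intro a ha
      have : a = 0 := by simpa [A] using ha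
      simp only [this, norm_zero, c]
      norm_num
    | succ n ih =>
      intro a ha
      rw [hAs, Finset.mem_union, Finset.mem_image, Finset.mem_image] at ha
      rcases ha with ⟨b, hb, rfl⟩ | ⟨b, hb, rfl⟩
      · exact (hf2 n (A n) ih b hb).1
      · exact (hf2 n (A n) ih b hb).2
  let x : ℕ → X := fun n => f n (A n)
  have hmem : ∀ (p : ℕ → Prop) (n : ℕ),
      ∑ k ∈ Finset.range n, (if p k then (1 : ℝ) else -1) • x k ∈ A n := by
    intro p n
    induction n with
    | zero => simp [A]
    | succ n ih =>
      rw [Finset.sum_range_succ, hAs, Finset.mem_union, Finset.mem_image, Finset.mem_image]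
      by_cases hp : p n
      · exact Or.inl ⟨_, ih, by simp [hp, x]⟩
      · exact Or.inr ⟨_, ih, by simp [hp, x, sub_eq_add_neg]⟩
  refine ⟨x, fun g F => ?_, fun n => hf1 n (A n) (hA n)⟩
  obtain ⟨n, hn⟩ := F.exists_nat_subset_range
  have hle := hA n _ (hmem (fun k => 0 ≤ g (x k)) n)
  calc ∑ k ∈ F, |g (x k)| ≤ ∑ k ∈ Finset.range n, |g (x k)| :=
        Finset.sum_le_sum_of_subset_of_nonneg hn fun _ _ _ => abs_nonneg _
    _ = g (∑ k ∈ Finset.range n, (if 0 ≤ g (x k) then (1 : ℝ) else -1) • x k) := by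
        rw [map_sum]
        refine Finset.sum_congr rfl fun k _ => ?_
        rw [map_smul, smul_eq_mul]
        split_ifs with h
        · rw [abs_of_nonneg h, one_mul]
        · rw [abs_of_neg (not_le.1 h)]
          ring
    _ ≤ ‖g‖ * 1 := by
        refine (le_abs_self _).trans (g.le_of_opNorm_le_of_le le_rfl (hle.trans ?_))
        simp only [c]
        linarith [(hpow n).1]
    _ = ‖g‖ := mul_one _

variable {x : ℕ → X}

theorem norm_sum_smul_le_of_wuc (hx : ∀ (g : X →L[ℝ] ℝ) (F : Finset ℕ), ∑ k ∈ F, |g (x k)| ≤ ‖g‖)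
    (F : Finset ℕ) (t : ℕ → ℝ) {M : ℝ} (hM : 0 ≤ M) (ht : ∀ k ∈ F, |t k| ≤ M) :
    ‖∑ k ∈ F, t k • x k‖ ≤ M := by
  refine NormedSpace.norm_le_dual_bound ℝ _ hM fun g => ?_
  calc ‖g (∑ k ∈ F, t k • x k)‖ = |∑ k ∈ F, t k * g (x k)| := by simp [map_sum]
    _ ≤ ∑ k ∈ F, |t k * g (x k)| := Finset.abs_sum_le_sum_abs _ _
    _ ≤ ∑ k ∈ F, M * |g (x k)| := Finset.sum_le_sum fun k hk => by
        rw [abs_mul]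
        exact mul_le_mul_of_nonneg_right (ht k hk) (abs_nonneg _)
    _ = M * ∑ k ∈ F, |g (x k)| := (Finset.mul_sum _ _ _).symm
    _ ≤ M * ‖g‖ := mul_le_mul_of_nonneg_left (hx g F) hM

theorem exists_almost_biorthogonal_of_wuc
    (hx : ∀ (g : X →L[ℝ] ℝ) (F : Finset ℕ), ∑ k ∈ F, |g (x k)| ≤ ‖g‖)
    (hn : ∀ n, 1 - (1 / 2 : ℝ) ^ n / 32 ≤ ‖x n‖) :
    ∃ g : ℕ → (X →L[ℝ] ℝ), ∀ n, ‖g n‖ ≤ 1 ∧ 1 - (1 / 2 : ℝ) ^ n / 32 ≤ g n (x n) ∧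
      ∀ F : Finset ℕ, ∑ k ∈ F.erase n, |g n (x k)| ≤ (1 / 2 : ℝ) ^ n / 32 := by
  choose g hg1 hg2 using fun n => exists_dual_vector'' ℝ (x n)
  have hg3 : ∀ n, 1 - (1 / 2 : ℝ) ^ n / 32 ≤ g n (x n) := fun n => by
    rw [hg2]
    exact hn n
  refine ⟨g, fun n => ⟨hg1 n, hg3 n, fun F => ?_⟩⟩
  have h1 := hx (g n) (insert n (F.erase n))
  rw [Finset.sum_insert (Finset.notMem_erase n F)] at h1
  linarith [le_abs_self (g n (x n)), hg1 n, hg3 n]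

theorem le_norm_sum_smul_of_wuc (hx : ∀ (g : X →L[ℝ] ℝ) (F : Finset ℕ), ∑ k ∈ F, |g (x k)| ≤ ‖g‖)
    (hn : ∀ n, 1 - (1 / 2 : ℝ) ^ n / 32 ≤ ‖x n‖) (F : Finset ℕ) (t : ℕ → ℝ) {n : ℕ} (hnF : n ∈ F) :
    (1 - (1 / 2 : ℝ) ^ (n + 2)) * |t n| ≤ ‖∑ k ∈ F, t k • x k‖ := by
  obtain ⟨g, hg⟩ := exists_almost_biorthogonal_of_wuc hx hn
  obtain ⟨m, hmF, hm⟩ := F.exists_max_image (fun k => |t k|) ⟨n, hnF⟩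
  set s := ∑ k ∈ F, t k • x k
  have hpow : ∀ n : ℕ, 0 < (1 / 2 : ℝ) ^ n ∧ (1 / 2 : ℝ) ^ n ≤ 1 := fun n =>
    ⟨by positivity, pow_le_one₀ (by norm_num) (by norm_num)⟩
  have key : ∀ j ∈ F, (1 - (1 / 2 : ℝ) ^ j / 32) * |t j| - (1 / 2 : ℝ) ^ j / 32 * |t m| ≤ ‖s‖ := by
    intro j hj
    obtain ⟨h1, h2, h3⟩ := hg j
    have hs : g j s = t j * g j (x j) + ∑ k ∈ F.erase j, t k * g j (x k) := by
      simp only [s, map_sum, map_smul, smul_eq_mul]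
      exact (Finset.add_sum_erase F _ hj).symm
    have hrest : |∑ k ∈ F.erase j, t k * g j (x k)| ≤ (1 / 2 : ℝ) ^ j / 32 * |t m| := by
      calc |∑ k ∈ F.erase j, t k * g j (x k)| ≤ ∑ k ∈ F.erase j, |t k * g j (x k)| :=
            Finset.abs_sum_le_sum_abs _ _
        _ ≤ ∑ k ∈ F.erase j, |g j (x k)| * |t m| := Finset.sum_le_sum fun k hk => by
            rw [abs_mul, mul_comm]
            exact mul_le_mul_of_nonneg_left (hm k (Finset.mem_of_mem_erase hk)) (abs_nonneg _)
        _ = (∑ k ∈ F.erase j, |g j (x k)|) * |t m| := (Finset.sum_mul _ _ _).symm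
        _ ≤ _ := mul_le_mul_of_nonneg_right (h3 F) (abs_nonneg _)
    have hgs : |g j s| ≤ ‖s‖ := by simpa using (g j).le_of_opNorm_le h1 s
    have hmain : (1 - (1 / 2 : ℝ) ^ j / 32) * |t j| ≤ |t j * g j (x j)| := by
      rw [abs_mul, mul_comm]
      exact mul_le_mul_of_nonneg_left (h2.trans (le_abs_self _)) (abs_nonneg _)
    have htri : |t j * g j (x j)| ≤ |g j s| + |∑ k ∈ F.erase j, t k * g j (x k)| := by
      have : t j * g j (x j) = g j s - ∑ k ∈ F.erase j, t k * g j (x k) := by rw [hs]; ring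
      rw [this]
      exact abs_sub _ _
    linarith
  have hm2 : |t m| ≤ 2 * ‖s‖ := by
    have := key m hmF
    nlinarith [hpow m, abs_nonneg (t m)]
  have hkn := key n hnF
  obtain ⟨h0, h1⟩ := hpow n
  set e := (1 / 2 : ℝ) ^ n / 32 with he
  have he' : (1 / 2 : ℝ) ^ (n + 2) = 8 * e := by rw [he, pow_add]; ring
  rw [he']
  have he0 : 0 < e := by positivity
  have he1 : e ≤ 1 / 32 := by linarith
  have h2 : (1 - e) * |t n| ≤ (1 + 2 * e) * ‖s‖ := by nlinarith
  have h3 : (1 + 2 * e) * ((1 - 8 * e) * |t n|) ≤ (1 + 2 * e) * ‖s‖ := by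
    refine le_trans ?_ h2
    nlinarith [mul_nonneg he0.le (abs_nonneg (t n)), mul_nonneg (mul_nonneg he0.le he0.le)
      (abs_nonneg (t n))]
  exact le_of_mul_le_mul_left h3 (by linarith)

theorem exists_l1_seq_of_wuc (hx : ∀ (g : X →L[ℝ] ℝ) (F : Finset ℕ), ∑ k ∈ F, |g (x k)| ≤ ‖g‖)
    (hn : ∀ n, 1 - (1 / 2 : ℝ) ^ n / 32 ≤ ‖x n‖) :
    ∃ g : ℕ → (X →L[ℝ] ℝ), (∀ n, ‖g n‖ ≤ 1) ∧ ∀ (F : Finset ℕ) (t : ℕ → ℝ),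
      ∑ k ∈ F, (1 - (1 / 2 : ℝ) ^ (k + 2)) * |t k| ≤ ‖∑ k ∈ F, t k • g k‖ := by
  classical
  obtain ⟨g, hg⟩ := exists_almost_biorthogonal_of_wuc hx hn
  refine ⟨g, fun n => (hg n).1, fun F t => ?_⟩
  let θ : ℕ → ℝ := fun k => if 0 ≤ t k then 1 else -1
  have hθ : ∀ k, |θ k| = 1 := fun k => by
    simp only [θ]
    split_ifs <;> simp
  have hθt : ∀ k, t k * θ k = |t k| := fun k => by
    simp only [θ]
    split_ifs with h
    · rw [abs_of_nonneg h, mul_one]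
    · rw [abs_of_neg (not_le.1 h)]
      ring
  set v := ∑ j ∈ F, θ j • x j with hv
  have hv1 : ‖v‖ ≤ 1 := norm_sum_smul_le_of_wuc hx F θ zero_le_one fun k _ => (hθ k).le
  have hpow : ∀ n : ℕ, 0 < (1 / 2 : ℝ) ^ n := fun n => by positivity
  have hterm : ∀ k ∈ F, (1 - (1 / 2 : ℝ) ^ (k + 2)) * |t k| ≤ t k * g k v := by
    intro k hk
    obtain ⟨h1, h2, h3⟩ := hg k
    have hs : g k v = θ k * g k (x k) + ∑ j ∈ F.erase k, θ j * g k (x j) := by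
      simp only [hv, map_sum, map_smul, smul_eq_mul]
      exact (Finset.add_sum_erase F _ hk).symm
    have hrest : |∑ j ∈ F.erase k, θ j * g k (x j)| ≤ (1 / 2 : ℝ) ^ k / 32 := by
      refine (Finset.abs_sum_le_sum_abs _ _).trans (le_trans (le_of_eq ?_) (h3 F))
      exact Finset.sum_congr rfl fun j _ => by rw [abs_mul, hθ, one_mul]
    have h4 : t k * g k v = |t k| * g k (x k) + t k * ∑ j ∈ F.erase k, θ j * g k (x j) := by
      rw [hs, ← hθt]
      ring
    have h5 : -(|t k| * ((1 / 2 : ℝ) ^ k / 32)) ≤ t k * ∑ j ∈ F.erase k, θ j * g k (x j) := by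
      refine le_trans (neg_le_neg ?_) (neg_abs_le _)
      rw [abs_mul]
      exact mul_le_mul_of_nonneg_left hrest (abs_nonneg _)
    have h6 : |t k| * (1 - (1 / 2 : ℝ) ^ k / 32) ≤ |t k| * g k (x k) :=
      mul_le_mul_of_nonneg_left h2 (abs_nonneg _)
    rw [h4, pow_add]
    nlinarith [mul_nonneg (hpow k).le (abs_nonneg (t k))]
  calc ∑ k ∈ F, (1 - (1 / 2 : ℝ) ^ (k + 2)) * |t k| ≤ ∑ k ∈ F, t k * g k v :=
        Finset.sum_le_sum hterm
    _ = (∑ k ∈ F, t k • g k) v := by simp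
    _ ≤ ‖∑ k ∈ F, t k • g k‖ := by
        refine (le_abs_self _).trans ?_
        simpa using (∑ k ∈ F, t k • g k).le_of_opNorm_le_of_le le_rfl hv1

theorem half_pow_add_two_mem_Ioo (n : ℕ) : (1 / 2 : ℝ) ^ (n + 2) ∈ Set.Ioo (0 : ℝ) 1 :=
  ⟨by positivity, pow_lt_one₀ (by norm_num) (by norm_num) (by omega)⟩

theorem tendsto_half_pow_add_two : Tendsto (fun n : ℕ => (1 / 2 : ℝ) ^ (n + 2)) atTop (nhds 0) :=
  (tendsto_pow_atTop_nhds_zero_of_lt_one (by norm_num) (by norm_num)).comp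
    (tendsto_add_atTop_nat 2)

theorem containsAsympIsoC0_of_bounds
    (hu : ∀ (F : Finset ℕ) (t : ℕ → ℝ) {M : ℝ}, 0 ≤ M → (∀ k ∈ F, |t k| ≤ M) →
      ‖∑ k ∈ F, t k • x k‖ ≤ M)
    (hl : ∀ (F : Finset ℕ) (t : ℕ → ℝ) {n : ℕ}, n ∈ F →
      (1 - (1 / 2 : ℝ) ^ (n + 2)) * |t n| ≤ ‖∑ k ∈ F, t k • x k‖) :
    ContainsAsympIsoC0 X := by
  refine ⟨_, half_pow_add_two_mem_Ioo, tendsto_half_pow_add_two, x, fun t => ⟨fun n => ?_, ?_⟩⟩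
  · by_cases hn : n ∈ t.support
    · exact hl _ t hn
    · simp [Finsupp.notMem_support_iff.1 hn]
  · have hbdd : BddAbove (Set.range fun n => |t n|) := by
      refine ⟨∑ k ∈ t.support, |t k|, ?_⟩
      rintro _ ⟨n, rfl⟩
      by_cases hn : n ∈ t.support
      · exact Finset.single_le_sum (f := fun k => |t k|) (fun _ _ => abs_nonneg _) hn
      · simpa [Finsupp.notMem_support_iff.1 hn] using
          Finset.sum_nonneg fun k (_ : k ∈ t.support) => abs_nonneg (t k)
    exact hu _ t (Real.iSup_nonneg fun n => abs_nonneg _) fun k _ => le_ciSup hbdd k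

theorem containsAsympIsoL1_of_bounds (hu : ∀ n, ‖x n‖ ≤ 1)
    (hl : ∀ (F : Finset ℕ) (t : ℕ → ℝ),
      ∑ k ∈ F, (1 - (1 / 2 : ℝ) ^ (k + 2)) * |t k| ≤ ‖∑ k ∈ F, t k • x k‖) :
    ContainsAsympIsoL1 X := by
  refine ⟨_, half_pow_add_two_mem_Ioo, tendsto_half_pow_add_two, x, fun t => ⟨hl _ t, ?_⟩⟩
  refine norm_sum_le_of_le _ fun k _ => ?_
  rw [norm_smul, Real.norm_eq_abs]
  exact mul_le_of_le_one_right (abs_nonneg _) (hu k)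

end Sequences

section FixedPoint

variable {E : Type*} [NormedAddCommGroup E] [NormedSpace ℝ E]

/-- A fixed point free self-map of a set in a model space, nonexpansive for the norm pulled back
along an isomorphic embedding, shows that the target fails the fixed point property. -/
theorem not_fpp_of_embedding {F : Type*} [NormedAddCommGroup F] [NormedSpace ℝ F]
    [CompleteSpace F] (S : F →L[ℝ] E) {K : NNReal} (hS : ∀ t, ‖t‖ ≤ K * ‖S t‖) {D : Set F}
    (hne : D.Nonempty) (hcl : IsClosed D) (hbd : Bornology.IsBounded D) (hcv : Convex ℝ D)
    (R : F → F) (hRD : Set.MapsTo R D D)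
    (hR : ∀ a ∈ D, ∀ b ∈ D, ‖S (R a - R b)‖ ≤ ‖S (a - b)‖) (hfix : ∀ a ∈ D, R a ≠ a) :
    ¬ FPP E := by
  intro hF
  have hanti : AntilipschitzWith K S := S.antilipschitz_of_bound hS
  have hinj := hanti.injective
  have hinv : ∀ a, Function.invFun S (S a) = a := Function.leftInverse_invFun hinj
  obtain ⟨_, ⟨a, ha, rfl⟩, hTa⟩ := hF (S '' D) (hne.image S)
    ((hanti.isClosedEmbedding S.uniformContinuous).isClosedMap D hcl)
    (S.lipschitz.isBounded_image hbd) (hcv.linear_image S.toLinearMap)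
    (fun e => S (R (Function.invFun S e))) (by
      rintro _ ⟨a, ha, rfl⟩
      exact ⟨R a, hRD ha, by simp only [hinv]⟩) (by
      rintro _ ⟨a, ha, rfl⟩ _ ⟨b, hb, rfl⟩
      simpa only [hinv, ← map_sub] using hR a ha b hb)
  rw [hinv] at hTa
  exact hfix a ha (hinj hTa)

/-- Rescaling factors which turn the shift into a nonexpansive map. -/
noncomputable def shiftWeight (n : ℕ) : ℝ := 1 + (1 / 2) ^ n

theorem one_le_shiftWeight (n : ℕ) : 1 ≤ shiftWeight n := by
  have : (0 : ℝ) < (1 / 2) ^ n := by positivity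
  simp only [shiftWeight]
  linarith

theorem shiftWeight_le_two (n : ℕ) : shiftWeight n ≤ 2 := by
  have : (1 / 2 : ℝ) ^ n ≤ 1 := pow_le_one₀ (by norm_num) (by norm_num)
  simp only [shiftWeight]
  linarith

theorem shiftWeight_succ_le (n : ℕ) :
    shiftWeight (n + 1) ≤ (1 - (1 / 2 : ℝ) ^ (n + 2)) * shiftWeight n := by
  have h0 : (0 : ℝ) < (1 / 2) ^ n := by positivity
  have h1 : (1 / 2 : ℝ) ^ n ≤ 1 := pow_le_one₀ (by norm_num) (by norm_num)
  simp only [shiftWeight, pow_add]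
  nlinarith

theorem abs_shiftWeight_mul (n : ℕ) (a : ℝ) : |shiftWeight n * a| = shiftWeight n * |a| := by
  rw [abs_mul, abs_of_nonneg (zero_le_one.trans (one_le_shiftWeight n))]

theorem shiftWeight_succ_mul_abs_le (n : ℕ) (a : ℝ) :
    |shiftWeight (n + 1) * a| ≤ (1 - (1 / 2 : ℝ) ^ (n + 2)) * |shiftWeight n * a| := by
  rw [abs_shiftWeight_mul, abs_shiftWeight_mul, ← mul_assoc]
  exact mul_le_mul_of_nonneg_right (shiftWeight_succ_le n) (abs_nonneg a)

theorem abs_le_shiftWeight_succ_mul (n : ℕ) (a : ℝ) : |a| ≤ |shiftWeight (n + 1) * a| := by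
  rw [abs_shiftWeight_mul]
  exact le_mul_of_one_le_left (abs_nonneg a) (one_le_shiftWeight _)

theorem tendsto_zeroAtInfty_nat (t : C₀(ℕ, ℝ)) : Tendsto t atTop (nhds 0) := by
  have := zero_at_infty t
  rwa [cocompact_eq_cofinite, Nat.cofinite_eq_atTop] at this

theorem ZeroAtInftyContinuousMap.norm_le_of_forall {t : C₀(ℕ, ℝ)} {M : ℝ} (hM : 0 ≤ M)
    (h : ∀ n, |t n| ≤ M) : ‖t‖ ≤ M := by
  rw [← ZeroAtInftyContinuousMap.norm_toBCF_eq_norm]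
  exact (BoundedContinuousFunction.norm_le hM).2 h

theorem ZeroAtInftyContinuousMap.abs_apply_le (t : C₀(ℕ, ℝ)) (n : ℕ) : |t n| ≤ ‖t‖ := by
  rw [← ZeroAtInftyContinuousMap.norm_toBCF_eq_norm]
  exact t.toBCF.norm_coe_le_norm n

/-- Prepend a value to a null sequence. -/
def zeroAtInftyCons (a : ℝ) (t : C₀(ℕ, ℝ)) : C₀(ℕ, ℝ) where
  toFun n := Nat.casesOn n a t
  continuous_toFun := continuous_of_discreteTopology
  zero_at_infty' := by
    rw [cocompact_eq_cofinite, Nat.cofinite_eq_atTop]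
    exact (tendsto_add_atTop_iff_nat 1).1 (tendsto_zeroAtInfty_nat t)

theorem zeroAtInftyCons_zero (a : ℝ) (t : C₀(ℕ, ℝ)) : zeroAtInftyCons a t 0 = a := rfl

theorem zeroAtInftyCons_succ (a : ℝ) (t : C₀(ℕ, ℝ)) (n : ℕ) :
    zeroAtInftyCons a t (n + 1) = t n := rfl

theorem not_fpp_of_c0_bounds [CompleteSpace E] {x : ℕ → E}
    (hu : ∀ (F : Finset ℕ) (t : ℕ → ℝ) {M : ℝ}, 0 ≤ M → (∀ k ∈ F, |t k| ≤ M) →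
      ‖∑ k ∈ F, t k • x k‖ ≤ M)
    (hl : ∀ (F : Finset ℕ) (t : ℕ → ℝ) {n : ℕ}, n ∈ F →
      (1 - (1 / 2 : ℝ) ^ (n + 2)) * |t n| ≤ ‖∑ k ∈ F, t k • x k‖) :
    ¬ FPP E := by
  have hsum : ∀ t : C₀(ℕ, ℝ), Summable fun n => (shiftWeight n * t n) • x n := by
    intro t
    rw [summable_iff_vanishing_norm]
    intro ε hε
    obtain ⟨N, hN⟩ := Metric.tendsto_atTop.1 (tendsto_zeroAtInfty_nat t) (ε / 4) (by positivity)
    refine ⟨Finset.range N, fun F hF => ?_⟩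
    refine (hu F (fun n => shiftWeight n * t n) (M := ε / 2) (by positivity)
      fun k hk => ?_).trans_lt (by linarith)
    have hk' : N ≤ k := by
      by_contra h
      exact Finset.disjoint_left.1 hF hk (Finset.mem_range.2 (not_le.1 h))
    have h1 := hN k hk'
    rw [Real.dist_eq, sub_zero] at h1
    rw [abs_shiftWeight_mul]
    nlinarith [shiftWeight_le_two k, abs_nonneg (t k)]
  have hupper : ∀ (t : C₀(ℕ, ℝ)) {M : ℝ}, 0 ≤ M → (∀ n, |shiftWeight n * t n| ≤ M) →
      ‖∑' n, (shiftWeight n * t n) • x n‖ ≤ M := fun t M hM h =>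
    le_of_tendsto (hsum t).hasSum.norm (Eventually.of_forall fun F => hu F _ hM fun k _ => h k)
  have hlower : ∀ (t : C₀(ℕ, ℝ)) (n : ℕ), (1 - (1 / 2 : ℝ) ^ (n + 2)) * |shiftWeight n * t n| ≤
      ‖∑' n, (shiftWeight n * t n) • x n‖ := fun t n => by
    refine ge_of_tendsto (hsum t).hasSum.norm ?_
    filter_upwards [eventually_ge_atTop {n}] with F hF
    exact hl F (fun n => shiftWeight n * t n) (hF (Finset.mem_singleton_self n))
  let S : C₀(ℕ, ℝ) →L[ℝ] E := LinearMap.mkContinuous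
    { toFun := fun t => ∑' n, (shiftWeight n * t n) • x n
      map_add' := fun s t => by
        rw [← (hsum s).tsum_add (hsum t)]
        simp only [ZeroAtInftyContinuousMap.add_apply, mul_add, add_smul]
      map_smul' := fun c t => by
        rw [RingHom.id_apply, ← (hsum t).tsum_const_smul c]
        simp only [ZeroAtInftyContinuousMap.smul_apply, smul_eq_mul, smul_smul]
        refine tsum_congr fun n => ?_
        congr 1
        ring } 2 fun t => by
      refine hupper t (by positivity) fun n => ?_
      rw [abs_shiftWeight_mul]
      exact mul_le_mul (shiftWeight_le_two n) (t.abs_apply_le n) (abs_nonneg _) zero_le_two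
  have hS : ∀ t, S t = ∑' n, (shiftWeight n * t n) • x n := fun t => rfl
  let D : Set C₀(ℕ, ℝ) := {t | ∀ n, t n ∈ Set.Icc (0 : ℝ) 1}
  have hcont : ∀ n, Continuous fun t : C₀(ℕ, ℝ) => t n := fun n => by
    refine (LipschitzWith.of_dist_le' (K := 1) fun s t => ?_).continuous
    rw [one_mul, dist_eq_norm, dist_eq_norm]
    exact (s - t).abs_apply_le n
  refine not_fpp_of_embedding S (K := 1) (fun t => ?_) (D := D)
    ⟨0, fun n => by simp⟩ ?_ ?_ ?_ (zeroAtInftyCons 1) ?_ ?_ ?_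
  · rw [NNReal.coe_one, one_mul]
    refine ZeroAtInftyContinuousMap.norm_le_of_forall (norm_nonneg _) fun n => ?_
    exact (abs_le_shiftWeight_succ_mul n _).trans
      ((shiftWeight_succ_mul_abs_le n _).trans (hlower t n))
  · have : D = ⋂ n, (fun t : C₀(ℕ, ℝ) => t n) ⁻¹' Set.Icc 0 1 := by
      ext t
      simp [D]
    rw [this]
    exact isClosed_iInter fun n => isClosed_Icc.preimage (hcont n)
  · refine isBounded_iff_forall_norm_le.2 ⟨1, fun t ht => ?_⟩
    refine ZeroAtInftyContinuousMap.norm_le_of_forall zero_le_one fun n => ?_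
    rw [abs_of_nonneg (ht n).1]
    exact (ht n).2
  · intro s hs t ht a b ha hb hab n
    exact convex_Icc (0 : ℝ) 1 (hs n) (ht n) ha hb hab
  · rintro t ht (_ | n)
    · simp [zeroAtInftyCons_zero]
    · exact ht n
  · intro s _ t _
    rw [hS (zeroAtInftyCons 1 s - zeroAtInftyCons 1 t)]
    refine hupper _ (norm_nonneg _) fun n => ?_
    rw [ZeroAtInftyContinuousMap.sub_apply]
    rcases n with _ | n
    · simp [zeroAtInftyCons_zero]
    · simp only [zeroAtInftyCons_succ]
      exact (shiftWeight_succ_mul_abs_le n _).trans (hlower (s - t) n)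
  · intro t _ ht
    have hone : ∀ n, t n = 1 := by
      intro n
      induction n with
      | zero => rw [← ht, zeroAtInftyCons_zero]
      | succ n ih => rw [← ht, zeroAtInftyCons_succ, ih]
    have := tendsto_zeroAtInfty_nat t
    simp only [funext hone] at this
    exact one_ne_zero (tendsto_nhds_unique tendsto_const_nhds this)

theorem lp_one_hasSum_abs (t : lp (fun _ : ℕ => ℝ) 1) : HasSum (fun n => |t n|) ‖t‖ := by
  simpa using lp.hasSum_norm (p := 1) (by simp) t

theorem lp_one_summable (t : lp (fun _ : ℕ => ℝ) 1) : Summable fun n => t n :=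
  (lp_one_hasSum_abs t).summable.of_abs

/-- The right shift on `ℓ₁`. -/
def lpOneShift (t : lp (fun _ : ℕ => ℝ) 1) : lp (fun _ : ℕ => ℝ) 1 :=
  ⟨fun n => Nat.casesOn n 0 t, memℓp_gen <| by
    rw [← summable_nat_add_iff 1]
    simpa using (lp_one_hasSum_abs t).summable⟩

theorem lpOneShift_zero (t : lp (fun _ : ℕ => ℝ) 1) : lpOneShift t 0 = 0 := rfl

theorem lpOneShift_succ (t : lp (fun _ : ℕ => ℝ) 1) (n : ℕ) : lpOneShift t (n + 1) = t n := rfl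

theorem norm_lpOneShift (t : lp (fun _ : ℕ => ℝ) 1) : ‖lpOneShift t‖ = ‖t‖ := by
  rw [← (lp_one_hasSum_abs (lpOneShift t)).tsum_eq, ← (lp_one_hasSum_abs t).tsum_eq,
    (lp_one_hasSum_abs (lpOneShift t)).summable.tsum_eq_zero_add]
  simp only [lpOneShift_zero, lpOneShift_succ, abs_zero, zero_add]

theorem not_fpp_of_l1_bounds [CompleteSpace E] {x : ℕ → E} (hu : ∀ n, ‖x n‖ ≤ 1)
    (hl : ∀ (F : Finset ℕ) (t : ℕ → ℝ),
      ∑ k ∈ F, (1 - (1 / 2 : ℝ) ^ (k + 2)) * |t k| ≤ ‖∑ k ∈ F, t k • x k‖) :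
    ¬ FPP E := by
  have hbound : ∀ (t : lp (fun _ : ℕ => ℝ) 1) (n : ℕ),
      ‖(shiftWeight n * t n) • x n‖ ≤ |shiftWeight n * t n| := fun t n => by
    rw [norm_smul, Real.norm_eq_abs]
    exact mul_le_of_le_one_right (abs_nonneg _) (hu n)
  have hle2 : ∀ (t : lp (fun _ : ℕ => ℝ) 1) (n : ℕ), |shiftWeight n * t n| ≤ 2 * |t n| :=
    fun t n => by
      rw [abs_shiftWeight_mul]
      exact mul_le_mul_of_nonneg_right (shiftWeight_le_two n) (abs_nonneg _)
  have habs : ∀ t : lp (fun _ : ℕ => ℝ) 1, Summable fun n => |shiftWeight n * t n| := fun t =>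
    ((lp_one_hasSum_abs t).summable.mul_left 2).of_nonneg_of_le (fun n => abs_nonneg _) (hle2 t)
  have hsum : ∀ t : lp (fun _ : ℕ => ℝ) 1, Summable fun n => (shiftWeight n * t n) • x n :=
    fun t => (habs t).of_norm_bounded (hbound t)
  have hupper : ∀ t : lp (fun _ : ℕ => ℝ) 1,
      ‖∑' n, (shiftWeight n * t n) • x n‖ ≤ ∑' n, |shiftWeight n * t n| := fun t =>
    tsum_of_norm_bounded (habs t).hasSum (hbound t)
  have hlower : ∀ (t : lp (fun _ : ℕ => ℝ) 1) (F : Finset ℕ),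
      ∑ n ∈ F, (1 - (1 / 2 : ℝ) ^ (n + 2)) * |shiftWeight n * t n| ≤
        ‖∑' n, (shiftWeight n * t n) • x n‖ := fun t F => by
    refine ge_of_tendsto (hsum t).hasSum.norm ?_
    filter_upwards [eventually_ge_atTop F] with G hG
    refine le_trans ?_ (hl G fun n => shiftWeight n * t n)
    refine Finset.sum_le_sum_of_subset_of_nonneg hG fun n _ _ => ?_
    exact mul_nonneg (sub_nonneg.2 (half_pow_add_two_mem_Ioo n).2.le) (abs_nonneg _)
  have hsucc : ∀ t : lp (fun _ : ℕ => ℝ) 1, Summable fun n => |shiftWeight (n + 1) * t n| :=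
    fun t => (habs t).of_nonneg_of_le (fun n => abs_nonneg _) fun n =>
      (shiftWeight_succ_mul_abs_le n _).trans
        (mul_le_of_le_one_left (abs_nonneg _) (by linarith [(half_pow_add_two_mem_Ioo n).1]))
  have hlower' : ∀ t : lp (fun _ : ℕ => ℝ) 1, ∑' n, |shiftWeight (n + 1) * t n| ≤
      ‖∑' n, (shiftWeight n * t n) • x n‖ := fun t =>
    (hsucc t).tsum_le_of_sum_le fun F =>
      (Finset.sum_le_sum fun n _ => shiftWeight_succ_mul_abs_le n _).trans (hlower t F)
  let S : lp (fun _ : ℕ => ℝ) 1 →L[ℝ] E := LinearMap.mkContinuous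
    { toFun := fun t => ∑' n, (shiftWeight n * t n) • x n
      map_add' := fun s t => by
        rw [← (hsum s).tsum_add (hsum t)]
        simp only [lp.coeFn_add, Pi.add_apply, mul_add, add_smul]
      map_smul' := fun c t => by
        rw [RingHom.id_apply, ← (hsum t).tsum_const_smul c]
        simp only [lp.coeFn_smul, Pi.smul_apply, smul_eq_mul, smul_smul]
        refine tsum_congr fun n => ?_
        congr 1
        ring } 2 fun t => by
      refine (hupper t).trans ?_
      rw [← ((lp_one_hasSum_abs t).mul_left 2).tsum_eq]
      exact (habs t).tsum_le_tsum (hle2 t) ((lp_one_hasSum_abs t).mul_left 2).summable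
  have hS : ∀ t, S t = ∑' n, (shiftWeight n * t n) • x n := fun t => rfl
  let D : Set (lp (fun _ : ℕ => ℝ) 1) := {t | (∀ n, 0 ≤ t n) ∧ ‖t‖ = 1}
  have hcont : ∀ n, Continuous fun t : lp (fun _ : ℕ => ℝ) 1 => t n := fun n => by
    refine (LipschitzWith.of_dist_le' (K := 1) fun s t => ?_).continuous
    rw [one_mul, dist_eq_norm, dist_eq_norm]
    exact lp.norm_apply_le_norm one_ne_zero (s - t) n
  have hnorm : ∀ t : lp (fun _ : ℕ => ℝ) 1, (∀ n, 0 ≤ t n) → ∑' n, t n = ‖t‖ := fun t ht => by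
    rw [← (lp_one_hasSum_abs t).tsum_eq]
    exact tsum_congr fun n => (abs_of_nonneg (ht n)).symm
  refine not_fpp_of_embedding S (K := 1) (fun t => ?_) (D := D)
    ⟨lp.single 1 0 1, fun n => ?_, ?_⟩ ?_ ?_ ?_ lpOneShift ?_ ?_ ?_
  · rw [NNReal.coe_one, one_mul, ← (lp_one_hasSum_abs t).tsum_eq]
    exact ((lp_one_hasSum_abs t).summable.tsum_le_tsum
      (fun n => abs_le_shiftWeight_succ_mul n _) (hsucc t)).trans (hlower' t)
  · rw [lp.single_apply]
    by_cases h : n = 0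
    · subst h
      simp
    · simp [h]
  · rw [lp.norm_single one_pos, norm_one]
  · have : D = (⋂ n, (fun t : lp (fun _ : ℕ => ℝ) 1 => t n) ⁻¹' Set.Ici 0) ∩
        norm ⁻¹' {(1 : ℝ)} := by
      ext t
      simp [D]
    rw [this]
    exact (isClosed_iInter fun n => isClosed_Ici.preimage (hcont n)).inter
      (isClosed_singleton.preimage continuous_norm)
  · exact isBounded_iff_forall_norm_le.2 ⟨1, fun t ht => ht.2.le⟩
  · intro s hs t ht a b ha hb hab
    have h0 : ∀ n, 0 ≤ (a • s + b • t) n := fun n =>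
      add_nonneg (mul_nonneg ha (hs.1 n)) (mul_nonneg hb (ht.1 n))
    refine ⟨h0, ?_⟩
    rw [← hnorm _ h0]
    have hsum1 := ((lp_one_summable s).hasSum.mul_left a).add
      ((lp_one_summable t).hasSum.mul_left b)
    rw [hnorm s hs.1, hnorm t ht.1, hs.2, ht.2, mul_one, mul_one, hab] at hsum1
    exact hsum1.tsum_eq
  · rintro t ht
    refine ⟨?_, by rw [norm_lpOneShift, ht.2]⟩
    rintro (_ | n)
    · exact (lpOneShift_zero t).ge
    · exact ht.1 n
  · intro s _ t _
    rw [hS (lpOneShift s - lpOneShift t)]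
    refine (hupper _).trans (le_trans (le_of_eq ?_) (hlower' (s - t)))
    rw [(habs _).tsum_eq_zero_add]
    simp only [lp.coeFn_sub, Pi.sub_apply, lpOneShift_zero, lpOneShift_succ, sub_zero, mul_zero,
      abs_zero, zero_add]
  · intro t ht hfix
    have hzero : ∀ n, t n = 0 := by
      intro n
      induction n with
      | zero => rw [← hfix, lpOneShift_zero]
      | succ n ih => rw [← hfix, lpOneShift_succ, ih]
    have h1 := hnorm t ht.1
    simp only [hzero, tsum_zero, ht.2] at h1
    exact zero_ne_one h1

end FixedPoint

theorem stmt17 (X : Type*) [NormedAddCommGroup X] [NormedSpace ℝ X] [CompleteSpace X]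
    [TopologicalSpace.SeparableSpace X]
    (hM : PropertyMStar X) (hr : ¬ IsReflexive X) :
    ContainsAsympIsoC0 X ∧ ¬ FPP X ∧ ContainsAsympIsoL1 (X →L[ℝ] ℝ) ∧ ¬ FPP (X →L[ℝ] ℝ) := by
  obtain ⟨x, hx, hn⟩ := hM.exists_wuc_seq hr
  obtain ⟨g, hg, hgl⟩ := exists_l1_seq_of_wuc hx hn
  exact ⟨containsAsympIsoC0_of_bounds (norm_sum_smul_le_of_wuc hx) (le_norm_sum_smul_of_wuc hx hn),
    not_fpp_of_c0_bounds (norm_sum_smul_le_of_wuc hx) (le_norm_sum_smul_of_wuc hx hn),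
    containsAsympIsoL1_of_bounds hg hgl, not_fpp_of_l1_bounds hg hgl⟩
end

section
/- Let X be a separable real Banach space with Property(M). Then X is reflexive if and only if neither ℓ₁ nor c₀ embeds isomorphically into X. -/
open Filter Topology ZeroAtInfty

section SequenceEmbeddings

variable {X : Type*} [NormedAddCommGroup X] [NormedSpace ℝ X] [CompleteSpace X]

/-- A bounded sequence with a lower `ℓ₁`-estimate spans an isomorphic copy of `ℓ₁`. -/
theorem embedsIso_ell1_of_lower_estimate (y : ℕ → X) {R c : ℝ} (hc : 0 < c)
    (hR : ∀ n, ‖y n‖ ≤ R)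
    (hlow : ∀ (n : ℕ) (a : ℕ → ℝ),
      c * ∑ i ∈ Finset.range n, |a i| ≤ ‖∑ i ∈ Finset.range n, a i • y i‖) :
    EmbedsIso (lp (fun _ : ℕ => ℝ) 1) X := by
  have hnorm : ∀ a : lp (fun _ : ℕ => ℝ) 1, HasSum (fun i => |a i|) ‖a‖ := by
    intro a
    have := lp.hasSum_norm (p := 1) (by simp) a
    simpa using this
  have hsn : ∀ a : lp (fun _ : ℕ => ℝ) 1, Summable (fun i => |a i| * R) := fun a =>
    (hnorm a).summable.mul_right R
  have hle : ∀ (a : lp (fun _ : ℕ => ℝ) 1) (i : ℕ), ‖a i • y i‖ ≤ |a i| * R := by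
    intro a i
    rw [norm_smul, Real.norm_eq_abs]
    exact mul_le_mul_of_nonneg_left (hR i) (abs_nonneg _)
  have hs : ∀ a : lp (fun _ : ℕ => ℝ) 1, Summable (fun i => a i • y i) := fun a =>
    Summable.of_norm_bounded (hsn a) (hle a)
  let T₀ : lp (fun _ : ℕ => ℝ) 1 →ₗ[ℝ] X :=
    { toFun := fun a => ∑' i, a i • y i
      map_add' := by
        intro a b
        rw [← (hs a).tsum_add (hs b)]
        simp [add_smul]
      map_smul' := by
        intro r a
        rw [RingHom.id_apply, ← (hs a).tsum_const_smul r]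
        simp [mul_smul] }
  let T : lp (fun _ : ℕ => ℝ) 1 →L[ℝ] X := T₀.mkContinuous R (by
    intro a
    have h1 := tsum_of_norm_bounded (f := fun i => a i • y i) ((hnorm a).mul_right R) (hle a)
    rw [mul_comm]
    exact h1)
  have hT : ∀ a, c * ‖a‖ ≤ ‖T a‖ := by
    intro a
    have h1 := (hs a).hasSum.tendsto_sum_nat.norm
    have h2 := ((hnorm a).tendsto_sum_nat).const_mul c
    exact le_of_tendsto_of_tendsto' h2 h1 (fun n => hlow n _)
  refine ⟨T, ?_, c, hc, hT⟩
  rw [injective_iff_map_eq_zero]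
  intro a ha
  have := hT a
  rw [ha, norm_zero] at this
  exact norm_le_zero_iff.1 (nonpos_of_mul_nonpos_right this hc)

/-- A sequence with an upper and a lower `c₀`-estimate spans an isomorphic copy of `c₀`. -/
theorem embedsIso_c0_of_estimates (y : ℕ → X) {C c : ℝ} (hc : 0 < c)
    (hup : ∀ (n : ℕ) (a : ℕ → ℝ), (∀ i, |a i| ≤ 1) → ‖∑ i ∈ Finset.range n, a i • y i‖ ≤ C)
    (hlow : ∀ (n : ℕ) (a : ℕ → ℝ), ∀ k < n,
      c * |a k| ≤ ‖∑ i ∈ Finset.range n, a i • y i‖) :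
    EmbedsIso C₀(ℕ, ℝ) X := by
  have hC : 0 ≤ C := by simpa using hup 0 0 (by simp)
  have hup' : ∀ (n : ℕ) (a : ℕ → ℝ) (r : ℝ), (∀ i, |a i| ≤ r) →
      ‖∑ i ∈ Finset.range n, a i • y i‖ ≤ C * r := by
    intro n a r hr
    have hr0 : 0 ≤ r := (abs_nonneg _).trans (hr 0)
    rcases hr0.eq_or_lt with h0 | h0
    · have : ∀ i, a i = 0 := fun i => by simpa [← h0] using hr i
      simp [this, ← h0]
    · have h1 := hup n (fun i => r⁻¹ * a i) (by
        intro i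
        rw [abs_mul, abs_of_pos (inv_pos.2 h0), inv_mul_le_iff₀ h0]
        simpa using hr i)
      simp only [mul_smul, ← Finset.smul_sum] at h1
      rw [norm_smul, Real.norm_eq_abs, abs_of_pos (inv_pos.2 h0), inv_mul_le_iff₀ h0] at h1
      linarith
  have hbd : ∀ (a : C₀(ℕ, ℝ)) (i : ℕ), |a i| ≤ ‖a‖ := by
    intro a i
    rw [← ZeroAtInftyContinuousMap.norm_toBCF_eq_norm]
    exact a.toBCF.norm_coe_le_norm i
  have hs : ∀ a : C₀(ℕ, ℝ), Summable (fun i => a i • y i) := by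
    intro a
    rw [summable_iff_vanishing_norm]
    intro ε hε
    have hz : Tendsto a atTop (𝓝 0) := by
      have := zero_at_infty a
      rwa [Filter.cocompact_eq_cofinite, Nat.cofinite_eq_atTop] at this
    have hδ : 0 < ε / (C + 1) := by positivity
    obtain ⟨N, hN⟩ := Metric.tendsto_atTop.1 hz _ hδ
    refine ⟨Finset.range N, fun t ht => ?_⟩
    obtain ⟨n, hn⟩ := t.exists_nat_subset_range
    have h1 := hup' n (fun i => if i ∈ t then a i else 0) (ε / (C + 1)) (by
      intro i
      split_ifs with hi
      · have : N ≤ i := by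
          by_contra hlt
          exact Finset.disjoint_left.1 ht hi (Finset.mem_range.2 (not_le.1 hlt))
        simpa using (hN i this).le
      · simpa using hδ.le)
    have h2 : ∑ i ∈ Finset.range n, (if i ∈ t then a i else 0) • y i = ∑ i ∈ t, a i • y i := by
      simp only [ite_smul, zero_smul]
      rw [Finset.sum_ite_mem, Finset.inter_eq_right.2 hn]
    rw [h2] at h1
    refine h1.trans_lt ?_
    rw [mul_div_assoc', div_lt_iff₀ (by positivity)]
    nlinarith
  let T₀ : C₀(ℕ, ℝ) →ₗ[ℝ] X :=
    { toFun := fun a => ∑' i, a i • y i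
      map_add' := by
        intro a b
        rw [← (hs a).tsum_add (hs b)]
        simp [add_smul]
      map_smul' := by
        intro r a
        rw [RingHom.id_apply, ← (hs a).tsum_const_smul r]
        simp [mul_smul] }
  let T : C₀(ℕ, ℝ) →L[ℝ] X := T₀.mkContinuous C (by
    intro a
    exact le_of_tendsto' (hs a).hasSum.tendsto_sum_nat.norm (fun n => hup' n _ _ (hbd a)))
  have hT : ∀ a, c * ‖a‖ ≤ ‖T a‖ := by
    intro a
    have hk : ∀ k, |a k| ≤ c⁻¹ * ‖T a‖ := by
      intro k
      rw [le_inv_mul_iff₀ hc]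
      refine ge_of_tendsto (hs a).hasSum.tendsto_sum_nat.norm ?_
      filter_upwards [eventually_gt_atTop k] with n hn
      exact hlow n a k hn
    have : ‖a‖ ≤ c⁻¹ * ‖T a‖ := by
      rw [← ZeroAtInftyContinuousMap.norm_toBCF_eq_norm]
      exact (BoundedContinuousFunction.norm_le (by positivity)).2 hk
    rwa [le_inv_mul_iff₀ hc] at this
  refine ⟨T, ?_, c, hc, hT⟩
  rw [injective_iff_map_eq_zero]
  intro a ha
  have := hT a
  rw [ha, norm_zero] at this
  exact norm_le_zero_iff.1 (nonpos_of_mul_nonpos_right this hc)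

end SequenceEmbeddings

section Selection

/-- Recursive construction of a sequence, when the `n`-th requirement depends only on the terms
of index at most `n` and can be met by changing the `n`-th term. -/
theorem exists_seq_forall_of_update {α : Type*} [Nonempty α] (Q : ℕ → (ℕ → α) → Prop)
    (hloc : ∀ n f g, (∀ i ≤ n, f i = g i) → Q n f → Q n g)
    (hstep : ∀ n f, ∃ y, Q n (Function.update f n y)) : ∃ f, ∀ n, Q n f := by
  choose nxt hnxt using hstep
  let s : ℕ → ℕ → α := fun n =>
    Nat.rec (fun _ => Classical.arbitrary α) (fun k f => Function.update f k (nxt k f)) n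
  have hs : ∀ n, s (n + 1) = Function.update (s n) n (nxt n (s n)) := fun n => rfl
  have hst : ∀ k n, k < n → s n k = s (k + 1) k := by
    intro k n hkn
    induction n, hkn using Nat.le_induction with
    | base => rfl
    | succ m hm ih =>
      rw [hs m, Function.update_of_ne (by omega), ih]
  refine ⟨fun k => s (k + 1) k, fun n => ?_⟩
  refine hloc n (s (n + 1)) _ (fun i hi => hst i (n + 1) (by omega)) ?_
  rw [hs]
  exact hnxt n (s n)

/-- Pointwise eventual inequalities are uniform on compact sets for equi-Lipschitz functions. -/
theorem IsCompact.eventually_forall_lt_of_equiLipschitz {P Y : Type*} [PseudoMetricSpace P]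
    {K : Set P} (hK : IsCompact K) {l : Filter Y} {h : P → Y → ℝ} {R : ℝ} {B : Set Y}
    (hB : B ∈ l) (hR : ∀ p q, ∀ y ∈ B, h q y ≤ h p y + R * dist q p)
    (hp : ∀ p ∈ K, ∀ ε > 0, ∀ᶠ y in l, h p y < ε) {ε : ℝ} (hε : 0 < ε) :
    ∀ᶠ y in l, ∀ p ∈ K, h p y < ε := by
  have hr : 0 < ε / (2 * (|R| + 1)) := by positivity
  obtain ⟨t, htK, htf, hcov⟩ := hK.finite_cover_balls hr
  have h1 : ∀ᶠ y in l, ∀ p ∈ t, h p y < ε / 2 := by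
    rw [htf.eventually_all]
    exact fun p hpt => hp p (htK hpt) _ (half_pos hε)
  filter_upwards [h1, hB] with y hy hyB q hq
  obtain ⟨p, hpt, hqp⟩ := Set.mem_iUnion₂.1 (hcov hq)
  have h2 := hR p q y hyB
  have h3 : R * dist q p ≤ ε / 2 := by
    have h4 : dist q p ≤ ε / (2 * (|R| + 1)) := (Metric.mem_ball.1 hqp).le
    calc R * dist q p ≤ (|R| + 1) * dist q p := by
          gcongr
          linarith [le_abs_self R]
      _ ≤ (|R| + 1) * (ε / (2 * (|R| + 1))) := by gcongr
      _ = ε / 2 := by field_simp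
  linarith [hy p hpt]

variable {X : Type*} [NormedAddCommGroup X] [NormedSpace ℝ X]

theorem isCompact_span_inter_closedBall_prod {s : Set X} (hs : s.Finite) (ρ : ℝ) :
    IsCompact (((Submodule.span ℝ s : Set X) ∩ Metric.closedBall 0 ρ) ×ˢ Set.Icc (-1 : ℝ) 1) := by
  have : FiniteDimensional ℝ (Submodule.span ℝ s) := FiniteDimensional.span_of_finite ℝ hs
  have hpr : ProperSpace (Submodule.span ℝ s) := FiniteDimensional.proper ℝ _
  refine IsCompact.prod ?_ isCompact_Icc
  have h := (isCompact_closedBall (0 : Submodule.span ℝ s) ρ).image continuous_subtype_val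
  convert h using 1
  ext x
  constructor
  · rintro ⟨h1, h2⟩
    exact ⟨⟨x, h1⟩, by simpa using h2, rfl⟩
  · rintro ⟨⟨z, hz⟩, h2, rfl⟩
    exact ⟨hz, by simpa using h2⟩

end Selection

section FilterCriteria

theorem image_Iio_congr {α : Type*} {f g : ℕ → α} {n : ℕ} (h : ∀ i ≤ n, f i = g i) :
    f '' Set.Iio n = g '' Set.Iio n :=
  Set.image_congr fun i hi => h i (le_of_lt hi)

variable {X : Type*} [NormedAddCommGroup X] [NormedSpace ℝ X]

theorem sum_range_smul_mem_span (f : ℕ → X) (a : ℕ → ℝ) (n : ℕ) :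
    ∑ i ∈ Finset.range n, a i • f i ∈ Submodule.span ℝ (f '' Set.Iio n) :=
  Submodule.sum_mem _ fun i hi => Submodule.smul_mem _ _
    (Submodule.subset_span ⟨i, Finset.mem_range.1 hi, rfl⟩)

theorem norm_add_smul_le_of_dist {y : X} {R : ℝ} (hy : ‖y‖ ≤ R) (p q : X × ℝ) :
    |‖q.1 + q.2 • y‖ - ‖p.1 + p.2 • y‖| ≤ (1 + R) * dist q p := by
  have hR : 0 ≤ R := (norm_nonneg y).trans hy
  refine (abs_norm_sub_norm_le _ _).trans ?_
  have h1 : q.1 + q.2 • y - (p.1 + p.2 • y) = (q.1 - p.1) + (q.2 - p.2) • y := by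
    rw [sub_smul]; abel
  have h2 : ‖q.1 - p.1‖ ≤ dist q p := by
    rw [← dist_eq_norm]; exact le_max_left _ _
  have h3 : |q.2 - p.2| ≤ dist q p := by
    rw [← Real.dist_eq]; exact le_max_right _ _
  rw [h1]
  refine (norm_add_le _ _).trans ?_
  rw [norm_smul, Real.norm_eq_abs]
  have h4 : |q.2 - p.2| * ‖y‖ ≤ dist q p * R :=
    mul_le_mul h3 hy (norm_nonneg _) dist_nonneg
  linarith

/-- If adding a generic vector of a bounded filter increases every norm by at least `c`, then
`ℓ₁` embeds. -/
theorem embedsIso_ell1_of_filter [CompleteSpace X] (𝒴 : Filter X) [𝒴.NeBot] {R c : ℝ}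
    (hc : 0 < c) (hR : Metric.closedBall 0 R ∈ 𝒴)
    (h : ∀ u : X, ∀ ε > 0, ∀ᶠ y in 𝒴, ‖u‖ + c - ε < ‖u + y‖) :
    EmbedsIso (lp (fun _ : ℕ => ℝ) 1) X := by
  have hR0 : 0 ≤ R := by
    obtain ⟨y, hy⟩ := 𝒴.nonempty_of_mem hR
    exact (norm_nonneg y).trans (by simpa using hy)
  have hts : ∀ (u : X) (t : ℝ), ∀ ε > 0, ∀ᶠ y in 𝒴, ‖u‖ + c * |t| - ‖u + t • y‖ < ε := by
    intro u t ε hε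
    rcases eq_or_ne t 0 with rfl | ht
    · simpa using hε
    · have ht' : 0 < |t| := abs_pos.2 ht
      filter_upwards [h (t⁻¹ • u) (ε / |t|) (by positivity)] with y hy
      have h1 : u + t • y = t • (t⁻¹ • u + y) := by rw [smul_add, smul_inv_smul₀ ht]
      rw [h1, norm_smul, Real.norm_eq_abs]
      rw [norm_smul, norm_inv, Real.norm_eq_abs] at hy
      have h2 := mul_lt_mul_of_pos_left hy ht'
      have h3 : |t| * (|t|⁻¹ * ‖u‖ + c - ε / |t|) = ‖u‖ + c * |t| - ε := by field_simp
      linarith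
  obtain ⟨f, hf⟩ := exists_seq_forall_of_update (α := X)
    (fun n f => ‖f n‖ ≤ R ∧ ∀ u ∈ Submodule.span ℝ (f '' Set.Iio n), ‖u‖ ≤ R → ∀ t : ℝ, |t| ≤ 1 →
      ‖u‖ + c * |t| - (c / 2) * (1 / 2) ^ (n + 1) ≤ ‖u + t • f n‖)
    (by
      intro n f g hfg hq
      simpa only [← hfg n le_rfl, ← image_Iio_congr hfg] using hq)
    (by
      intro n f
      have hK := isCompact_span_inter_closedBall_prod
        (s := f '' Set.Iio n) ((Set.finite_Iio n).image f) R
      have hev := hK.eventually_forall_lt_of_equiLipschitz (l := 𝒴) (R := 1 + c + (1 + R))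
        (h := fun p y => ‖p.1‖ + c * |p.2| - ‖p.1 + p.2 • y‖) hR
        (by
          intro p q y hy
          have h1 := norm_add_smul_le_of_dist (by simpa using hy : ‖y‖ ≤ R) p q
          have h2 : ‖q.1‖ - ‖p.1‖ ≤ dist q p :=
            (norm_sub_norm_le _ _).trans (by rw [← dist_eq_norm]; exact le_max_left _ _)
          have h3 : |q.2| - |p.2| ≤ dist q p :=
            (abs_sub_abs_le_abs_sub _ _).trans (by rw [← Real.dist_eq]; exact le_max_right _ _)
          have h4 := mul_le_mul_of_nonneg_left h3 hc.le
          have h5 := (abs_le.1 h1).1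
          nlinarith)
        (fun p _ => hts p.1 p.2) (ε := (c / 2) * (1 / 2) ^ (n + 1)) (by positivity)
      obtain ⟨y, hy, hyR⟩ := (hev.and hR).exists
      refine ⟨y, ?_⟩
      have himg : Function.update f n y '' Set.Iio n = f '' Set.Iio n :=
        Set.image_congr fun i hi => Function.update_of_ne (ne_of_lt hi) _ _
      simp only [himg, Function.update_self]
      refine ⟨by simpa using hyR, fun u hu hur t ht => ?_⟩
      have := hy (u, t) ⟨⟨hu, by simpa using hur⟩, abs_le.1 ht⟩
      linarith)
  refine embedsIso_ell1_of_lower_estimate f (half_pos hc) (fun n => (hf n).1) ?_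
  have key : ∀ (n : ℕ) (a : ℕ → ℝ), ∑ i ∈ Finset.range n, |a i| ≤ 1 → ∀ m ≤ n,
      c * ∑ i ∈ Finset.range m, |a i| - (c / 2) * (1 - (1 / 2) ^ m) ≤
        ‖∑ i ∈ Finset.range m, a i • f i‖ := by
    intro n a ha m hm
    induction m with
    | zero => simp
    | succ m ih =>
      have hsub : ∑ i ∈ Finset.range (m + 1), |a i| ≤ 1 :=
        (Finset.sum_le_sum_of_subset_of_nonneg (Finset.range_mono hm)
          (fun _ _ _ => abs_nonneg _)).trans ha
      rw [Finset.sum_range_succ] at hsub ⊢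
      rw [Finset.sum_range_succ]
      have h0 : 0 ≤ ∑ i ∈ Finset.range m, |a i| := Finset.sum_nonneg fun _ _ => abs_nonneg _
      have h1 : ‖∑ i ∈ Finset.range m, a i • f i‖ ≤ R := by
        refine (norm_sum_le _ _).trans ?_
        calc ∑ i ∈ Finset.range m, ‖a i • f i‖ ≤ ∑ i ∈ Finset.range m, |a i| * R := by
              refine Finset.sum_le_sum fun i _ => ?_
              rw [norm_smul, Real.norm_eq_abs]
              exact mul_le_mul_of_nonneg_left (hf i).1 (abs_nonneg _)
          _ = (∑ i ∈ Finset.range m, |a i|) * R := (Finset.sum_mul _ _ _).symm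
          _ ≤ 1 * R := by
              gcongr
              linarith [abs_nonneg (a m)]
          _ = R := one_mul R
      have h2 := (hf m).2 _ (sum_range_smul_mem_span f a m) h1 (a m) (by linarith)
      have h3 := ih (by omega)
      have h4 : (1 / 2 : ℝ) ^ (m + 1) = (1 / 2) ^ m / 2 := by ring
      rw [h4] at h2 ⊢
      linarith
  intro n a
  have hσ0 : 0 ≤ ∑ i ∈ Finset.range n, |a i| := Finset.sum_nonneg fun _ _ => abs_nonneg _
  rcases hσ0.eq_or_lt with h0 | h0
  · rw [← h0]; simp
  · set σ := ∑ i ∈ Finset.range n, |a i| with hσ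
    have h1 : ∑ i ∈ Finset.range n, |σ⁻¹ * a i| = 1 := by
      simp only [abs_mul, abs_of_pos (inv_pos.2 h0), ← Finset.mul_sum]
      exact inv_mul_cancel₀ h0.ne'
    have h2 := key n (fun i => σ⁻¹ * a i) h1.le n le_rfl
    simp only [mul_smul, ← Finset.smul_sum] at h2
    rw [h1, norm_smul, Real.norm_eq_abs, abs_of_pos (inv_pos.2 h0)] at h2
    have h3 : c / 2 ≤ σ⁻¹ * ‖∑ i ∈ Finset.range n, a i • f i‖ := by
      have : (0 : ℝ) ≤ (1 / 2) ^ n := by positivity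
      nlinarith
    rw [le_inv_mul_iff₀ h0] at h3
    linarith

/-- If for a fixed radius `B` there are bounded, weakly null filters, bounded away from zero,
whose generic vectors increase norms up to `B` by arbitrarily little, then `c₀` embeds. -/
theorem embedsIso_c0_of_filter [CompleteSpace X] {R B δ : ℝ} (hδ : 0 < δ) (hB : 0 ≤ B)
    (h : ∀ η > 0, ∃ 𝒴 : Filter X, 𝒴.NeBot ∧ Metric.closedBall 0 R ∈ 𝒴 ∧
      (∀ᶠ y in 𝒴, δ ≤ ‖y‖) ∧ (∀ g : X →L[ℝ] ℝ, Tendsto g 𝒴 (𝓝 0)) ∧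
      ∀ u : X, ∀ᶠ y in 𝒴, ‖u + y‖ < max ‖u‖ B + η) :
    EmbedsIso C₀(ℕ, ℝ) X := by
  obtain ⟨θ, hθ0, hθ1, hθδ⟩ : ∃ θ : ℝ, 0 < θ ∧ θ ≤ 1 ∧ θ ≤ δ / 4 :=
    ⟨min 1 (δ / 4), by positivity, min_le_left _ _, min_le_right _ _⟩
  obtain ⟨f, hf⟩ := exists_seq_forall_of_update (α := X)
    (fun n f => δ ≤ ‖f n‖ ∧ ∀ u ∈ Submodule.span ℝ (f '' Set.Iio n), ‖u‖ ≤ B + 1 →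
      ∀ t : ℝ, |t| ≤ 1 → ‖u + t • f n‖ ≤ max ‖u‖ B + θ * (1 / 2) ^ (n + 1) ∧
      ‖u‖ - θ * (1 / 2) ^ (n + 1) ≤ ‖u + t • f n‖)
    (by
      intro n f g hfg hq
      simpa only [← hfg n le_rfl, ← image_Iio_congr hfg] using hq)
    (by
      intro n f
      have hη : 0 < θ * (1 / 2) ^ (n + 1) := by positivity
      obtain ⟨𝒴, hne, hR, hyδ, hwn, hup⟩ := h (θ * (1 / 2) ^ (n + 1) / 2) (by positivity)
      have hK := isCompact_span_inter_closedBall_prod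
        (s := f '' Set.Iio n) ((Set.finite_Iio n).image f) (B + 1)
      have hev1 := hK.eventually_forall_lt_of_equiLipschitz (l := 𝒴) (R := 1 + (1 + R))
        (h := fun p y => ‖p.1‖ - ‖p.1 + p.2 • y‖) hR
        (by
          intro p q y hy
          have h1 := norm_add_smul_le_of_dist (by simpa using hy : ‖y‖ ≤ R) p q
          have h2 : ‖q.1‖ - ‖p.1‖ ≤ dist q p :=
            (norm_sub_norm_le _ _).trans (by rw [← dist_eq_norm]; exact le_max_left _ _)
          have h5 := (abs_le.1 h1).1
          nlinarith)
        (by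
          rintro ⟨u, t⟩ - ε hε
          obtain ⟨g, hg, hgu⟩ := exists_dual_vector'' ℝ u
          have h1 : Tendsto (fun y => t * g y) 𝒴 (𝓝 (t * 0)) := (hwn g).const_mul t
          rw [mul_zero] at h1
          filter_upwards [h1.eventually (lt_mem_nhds (neg_lt_zero.2 hε))] with y hy
          have h2 : g (u + t • y) ≤ ‖u + t • y‖ :=
            (le_abs_self _).trans ((g.le_opNorm _).trans
              (mul_le_of_le_one_left (norm_nonneg _) hg))
          rw [map_add, map_smul, hgu, smul_eq_mul] at h2
          simp only [RCLike.ofReal_real_eq_id, id] at h2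
          linarith) hη
      have hev2 := hK.eventually_forall_lt_of_equiLipschitz (l := 𝒴) (R := 1 + (1 + R))
        (h := fun p y => ‖p.1 + p.2 • y‖ - max ‖p.1‖ B - θ * (1 / 2) ^ (n + 1) / 2) hR
        (by
          intro p q y hy
          have h1 := norm_add_smul_le_of_dist (by simpa using hy : ‖y‖ ≤ R) p q
          have h2 : ‖p.1‖ - ‖q.1‖ ≤ dist q p :=
            (norm_sub_norm_le _ _).trans
              (by rw [← dist_eq_norm, dist_comm]; exact le_max_left _ _)
          have h3 : max ‖p.1‖ B ≤ max ‖q.1‖ B + dist q p := by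
            refine max_le ?_ ?_
            · linarith [le_max_left ‖q.1‖ B]
            · have : 0 ≤ dist q p := dist_nonneg
              linarith [le_max_right ‖q.1‖ B]
          have h5 := (abs_le.1 h1).2
          nlinarith)
        (by
          rintro ⟨u, t⟩ ⟨-, ht⟩ ε hε
          filter_upwards [hup u, hup (-u)] with y h1 h2
          rw [norm_neg] at h2
          have h3 : u + t • y = ((1 + t) / 2) • (u + y) + (-((1 - t) / 2)) • (-u + y) := by
            module
          have h4 : ‖u + t • y‖ ≤ (1 + t) / 2 * ‖u + y‖ + (1 - t) / 2 * ‖-u + y‖ := by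
            rw [h3]
            refine (norm_add_le _ _).trans ?_
            rw [norm_smul, norm_smul, norm_neg, Real.norm_eq_abs, Real.norm_eq_abs,
              abs_of_nonneg (by linarith [ht.1]), abs_of_nonneg (by linarith [ht.2])]
          have h5 : (1 + t) / 2 * ‖u + y‖ ≤ (1 + t) / 2 * (max ‖u‖ B + θ * (1 / 2) ^ (n + 1) / 2) :=
            mul_le_mul_of_nonneg_left h1.le (by linarith [ht.1])
          have h6 : (1 - t) / 2 * ‖-u + y‖ ≤
              (1 - t) / 2 * (max ‖u‖ B + θ * (1 / 2) ^ (n + 1) / 2) :=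
            mul_le_mul_of_nonneg_left h2.le (by linarith [ht.2])
          linarith) (half_pos hη)
      obtain ⟨y, hy1, hy2, hyδ⟩ := (hev1.and (hev2.and hyδ)).exists
      refine ⟨y, ?_⟩
      have himg : Function.update f n y '' Set.Iio n = f '' Set.Iio n :=
        Set.image_congr fun i hi => Function.update_of_ne (ne_of_lt hi) _ _
      simp only [himg, Function.update_self]
      refine ⟨hyδ, fun u hu hur t ht => ?_⟩
      have h1 := hy1 (u, t) ⟨⟨hu, by simpa using hur⟩, abs_le.1 ht⟩
      have h2 := hy2 (u, t) ⟨⟨hu, by simpa using hur⟩, abs_le.1 ht⟩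
      constructor <;> linarith)
  have hup : ∀ (n : ℕ) (a : ℕ → ℝ), (∀ i, |a i| ≤ 1) →
      ‖∑ i ∈ Finset.range n, a i • f i‖ ≤ B + θ * (1 - (1 / 2) ^ n) := by
    intro n a ha
    induction n with
    | zero => simpa using hB
    | succ n ih =>
      rw [Finset.sum_range_succ]
      have h4 : (1 / 2 : ℝ) ^ (n + 1) = (1 / 2) ^ n / 2 := by ring
      have h5 : (0 : ℝ) ≤ θ * (1 / 2) ^ n := by positivity
      have h6 : (0 : ℝ) ≤ θ * (1 - (1 / 2) ^ n) :=
        mul_nonneg hθ0.le (sub_nonneg.2 (pow_le_one₀ (by norm_num) (by norm_num)))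
      have h7 := ((hf n).2 _ (sum_range_smul_mem_span f a n) (by linarith) (a n) (ha n)).1
      have h8 : max ‖∑ i ∈ Finset.range n, a i • f i‖ B ≤ B + θ * (1 - (1 / 2) ^ n) :=
        max_le ih (by linarith)
      rw [h4] at h7 ⊢
      linarith
  have hup' : ∀ (n : ℕ) (a : ℕ → ℝ), (∀ i, |a i| ≤ 1) →
      ‖∑ i ∈ Finset.range n, a i • f i‖ ≤ B + 1 := by
    intro n a ha
    have : (0 : ℝ) ≤ θ * (1 / 2) ^ n := by positivity
    linarith [hup n a ha]
  have hmono : ∀ (a : ℕ → ℝ), (∀ i, |a i| ≤ 1) → ∀ k n, k ≤ n →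
      ‖∑ i ∈ Finset.range k, a i • f i‖ - θ * (1 - (1 / 2) ^ n) ≤
        ‖∑ i ∈ Finset.range n, a i • f i‖ := by
    intro a ha k n hkn
    induction n, hkn using Nat.le_induction with
    | base =>
      have h6 : (0 : ℝ) ≤ θ * (1 - (1 / 2) ^ k) :=
        mul_nonneg hθ0.le (sub_nonneg.2 (pow_le_one₀ (by norm_num) (by norm_num)))
      linarith
    | succ n hn ih =>
      rw [Finset.sum_range_succ _ n]
      have h4 : (1 / 2 : ℝ) ^ (n + 1) = (1 / 2) ^ n / 2 := by ring
      have h7 := ((hf n).2 _ (sum_range_smul_mem_span f a n) (hup' n a ha) (a n) (ha n)).2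
      rw [h4] at h7 ⊢
      linarith
  have hlow : ∀ (n : ℕ) (a : ℕ → ℝ), (∀ i, |a i| ≤ 1) → ∀ k < n, |a k| = 1 →
      δ / 4 ≤ ‖∑ i ∈ Finset.range n, a i • f i‖ := by
    intro n a ha k hk hak
    have h1 := hmono a ha k n hk.le
    have h2 := hmono a ha (k + 1) n hk
    have h3 : ‖a k • f k‖ ≤
        ‖∑ i ∈ Finset.range (k + 1), a i • f i‖ + ‖∑ i ∈ Finset.range k, a i • f i‖ := by
      rw [Finset.sum_range_succ]
      refine le_trans (le_of_eq ?_) (norm_sub_le _ _)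
      rw [add_sub_cancel_left]
    rw [norm_smul, Real.norm_eq_abs, hak, one_mul] at h3
    have h5 : (0 : ℝ) ≤ θ * (1 / 2) ^ n := by positivity
    linarith [(hf k).1]
  refine embedsIso_c0_of_estimates f (c := δ / 4) (by positivity) hup' ?_
  intro n a k hk
  obtain ⟨m, hm, hmax⟩ := Finset.exists_max_image (Finset.range n) (fun i => |a i|)
    ⟨k, Finset.mem_range.2 hk⟩
  have hkm : |a k| ≤ |a m| := hmax k (Finset.mem_range.2 hk)
  rcases (abs_nonneg (a m)).eq_or_lt with h0 | h0
  · have : |a k| = 0 := le_antisymm (h0 ▸ hkm) (abs_nonneg _)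
    rw [this]; simp
  · have h1 := hlow n (fun i => if i < n then |a m|⁻¹ * a i else 0) (by
      intro i
      by_cases hi : i < n
      · simp only [hi, if_true]
        rw [abs_mul, abs_inv, abs_abs, inv_mul_le_iff₀ h0, mul_one]
        exact hmax i (Finset.mem_range.2 hi)
      · simp [hi]) m (Finset.mem_range.1 hm) (by
      simp only [Finset.mem_range.1 hm, if_true]
      rw [abs_mul, abs_inv, abs_abs, inv_mul_cancel₀ h0.ne'])
    have h2 : ∑ i ∈ Finset.range n, (if i < n then |a m|⁻¹ * a i else 0) • f i =
        |a m|⁻¹ • ∑ i ∈ Finset.range n, a i • f i := by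
      rw [Finset.smul_sum]
      refine Finset.sum_congr rfl fun i hi => ?_
      rw [if_pos (Finset.mem_range.1 hi), mul_smul]
    rw [h2, norm_smul, norm_inv, norm_abs_eq_norm, Real.norm_eq_abs, le_inv_mul_iff₀ h0] at h1
    nlinarith

end FilterCriteria

section UltrafilterShift

variable {X : Type*} [NormedAddCommGroup X]

/-- The limit of the translates `φ (u + x)` as `x` runs along an ultrafilter. -/
noncomputable def shiftLim (𝒰 : Ultrafilter X) (φ : X → ℝ) (u : X) : ℝ :=
  limUnder (𝒰 : Filter X) (fun x => φ (u + x))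

/-- The convolution of two ultrafilters on an additive group. -/
def Ultrafilter.convAdd (𝒰 𝒱 : Ultrafilter X) : Ultrafilter X :=
  𝒰.bind fun x => 𝒱.map (x + ·)

theorem Ultrafilter.eventually_convAdd {𝒰 𝒱 : Ultrafilter X} {p : X → Prop} :
    (∀ᶠ z in (𝒰.convAdd 𝒱 : Filter X), p z) ↔
      ∀ᶠ x in (𝒰 : Filter X), ∀ᶠ y in (𝒱 : Filter X), p (x + y) :=
  Iff.rfl

/-- The reflection of an ultrafilter through the origin. -/
def Ultrafilter.reflect (𝒰 : Ultrafilter X) : Ultrafilter X :=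
  𝒰.map Neg.neg

theorem Ultrafilter.eventually_reflect {𝒰 : Ultrafilter X} {p : X → Prop} :
    (∀ᶠ z in (𝒰.reflect : Filter X), p z) ↔ ∀ᶠ x in (𝒰 : Filter X), p (-x) :=
  Iff.rfl

variable {𝒰 𝒱 : Ultrafilter X} {R S : ℝ} {φ ψ : X → ℝ}

theorem closedBall_mem_convAdd (hU : Metric.closedBall 0 R ∈ 𝒰) (hV : Metric.closedBall 0 S ∈ 𝒱) :
    Metric.closedBall 0 (R + S) ∈ 𝒰.convAdd 𝒱 := by
  refine Ultrafilter.eventually_convAdd.2 ?_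
  filter_upwards [hU] with x hx
  filter_upwards [hV] with y hy
  rw [mem_closedBall_zero_iff] at hx hy
  refine mem_closedBall_zero_iff.2 ?_
  exact (norm_add_le _ _).trans (add_le_add hx hy)

theorem closedBall_mem_reflect (hU : Metric.closedBall 0 R ∈ 𝒰) :
    Metric.closedBall 0 R ∈ 𝒰.reflect := by
  refine Ultrafilter.eventually_reflect.2 ?_
  filter_upwards [hU] with x hx
  simpa using hx

theorem tendsto_shiftLim (hU : Metric.closedBall 0 R ∈ 𝒰) (hφ : LipschitzWith 1 φ) (u : X) :
    Tendsto (fun x => φ (u + x)) 𝒰 (𝓝 (shiftLim 𝒰 φ u)) := by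
  refine tendsto_nhds_limUnder ?_
  have hK : IsCompact (Metric.closedBall (φ u) R) := isCompact_closedBall _ _
  obtain ⟨L, -, hL⟩ := hK.ultrafilter_le_nhds (𝒰.map fun x => φ (u + x)) (by
    rw [le_principal_iff]
    refine mem_map.2 ?_
    filter_upwards [hU] with x hx
    have h1 := hφ.dist_le_mul (u + x) u
    simp only [NNReal.coe_one, one_mul, dist_self_add_left] at h1
    exact h1.trans (by simpa using hx))
  exact ⟨L, hL⟩

theorem shiftLim_le_add (hU : Metric.closedBall 0 R ∈ 𝒰) (hφ : LipschitzWith 1 φ)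
    (hψ : LipschitzWith 1 ψ) {u v : X} {c : ℝ} (h : ∀ x, φ (u + x) ≤ ψ (v + x) + c) :
    shiftLim 𝒰 φ u ≤ shiftLim 𝒰 ψ v + c :=
  le_of_tendsto_of_tendsto' (tendsto_shiftLim hU hφ u)
    ((tendsto_shiftLim hU hψ v).add_const c) h

theorem lipschitzWith_shiftLim (hU : Metric.closedBall 0 R ∈ 𝒰) (hφ : LipschitzWith 1 φ) :
    LipschitzWith 1 (shiftLim 𝒰 φ) := by
  refine LipschitzWith.of_le_add fun u v => shiftLim_le_add hU hφ hφ fun x => ?_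
  simpa using hφ.le_add_mul (u + x) (v + x)

theorem shiftLim_le_self_add (hU : Metric.closedBall 0 R ∈ 𝒰) (hφ : LipschitzWith 1 φ) (u : X) :
    shiftLim 𝒰 φ u ≤ φ u + R := by
  refine le_of_tendsto (tendsto_shiftLim hU hφ u) ?_
  filter_upwards [hU] with x hx
  have h1 := hφ.le_add_mul (u + x) u
  simp only [NNReal.coe_one, one_mul, dist_self_add_left] at h1
  linarith [mem_closedBall_zero_iff.1 hx]

theorem self_le_shiftLim_add (hU : Metric.closedBall 0 R ∈ 𝒰) (hφ : LipschitzWith 1 φ) (u : X) :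
    φ u ≤ shiftLim 𝒰 φ u + R := by
  refine ge_of_tendsto ((tendsto_shiftLim hU hφ u).add_const R) ?_
  filter_upwards [hU] with x hx
  have h1 := hφ.le_add_mul u (u + x)
  simp only [NNReal.coe_one, one_mul, dist_self_add_right] at h1
  linarith [mem_closedBall_zero_iff.1 hx]

theorem shiftLim_comp (hU : Metric.closedBall 0 R ∈ 𝒰) (hφ : LipschitzWith 1 φ) {g : ℝ → ℝ}
    (hg : Continuous g) : shiftLim 𝒰 (g ∘ φ) = g ∘ shiftLim 𝒰 φ := by
  ext u
  exact ((hg.tendsto _).comp (tendsto_shiftLim hU hφ u)).limUnder_eq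

theorem shiftLim_convAdd (hU : Metric.closedBall 0 R ∈ 𝒰) (hV : Metric.closedBall 0 S ∈ 𝒱)
    (hφ : LipschitzWith 1 φ) :
    shiftLim (𝒰.convAdd 𝒱) φ = shiftLim 𝒰 (shiftLim 𝒱 φ) := by
  ext u
  refine Tendsto.limUnder_eq ?_
  rw [Metric.tendsto_nhds]
  intro ε hε
  rw [Ultrafilter.eventually_convAdd]
  filter_upwards [Metric.tendsto_nhds.1
    (tendsto_shiftLim hU (lipschitzWith_shiftLim hV hφ) u) _ (half_pos hε)] with x hx
  filter_upwards [Metric.tendsto_nhds.1 (tendsto_shiftLim hV hφ (u + x)) _ (half_pos hε)] with y hy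
  rw [← add_assoc]
  refine (dist_triangle _ _ _).trans_lt ((add_lt_add hy hx).trans_eq (add_halves ε))

theorem shiftLim_reflect_norm_neg (hU : Metric.closedBall 0 R ∈ 𝒰) (u : X) :
    shiftLim 𝒰.reflect norm (-u) = shiftLim 𝒰 norm u := by
  refine Tendsto.limUnder_eq ?_
  have h := tendsto_shiftLim hU lipschitzWith_one_norm u
  change Tendsto (fun x => ‖-u + x‖) (map Neg.neg (𝒰 : Filter X)) _
  rw [tendsto_map'_iff]
  refine h.congr fun x => ?_
  rw [Function.comp_apply, ← neg_add, norm_neg]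

theorem reflect_convAdd (𝒰 𝒱 : Ultrafilter X) :
    (𝒰.convAdd 𝒱).reflect = 𝒰.reflect.convAdd 𝒱.reflect := by
  refine Ultrafilter.ext fun s => ?_
  change (∀ᶠ z in (𝒰.convAdd 𝒱 : Filter X), -z ∈ s) ↔
    ∀ᶠ x in (𝒰.reflect : Filter X), ∀ᶠ y in (𝒱.reflect : Filter X), x + y ∈ s
  simp only [Ultrafilter.eventually_convAdd, Ultrafilter.eventually_reflect, neg_add]

end UltrafilterShift

section GaugeIteration

variable {X : Type*} [NormedAddCommGroup X]

/-- `F` computes the limits of `‖u + (x - y)‖` and `‖u + (y - x)‖` along `𝒲 × 𝒲` in terms of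
`‖u‖`. -/
structure Ultrafilter.IsGauge (𝒲 : Ultrafilter X) (F : ℝ → ℝ) : Prop where
  convAdd_reflect : shiftLim (𝒲.convAdd 𝒲.reflect) norm = F ∘ norm
  reflect_convAdd : shiftLim (𝒲.reflect.convAdd 𝒲) norm = F ∘ norm
  lipschitz : LipschitzWith 1 F
  nonneg : ∀ s, 0 ≤ F s
  monotone : MonotoneOn F (Set.Ici 0)

variable {𝒲 : Ultrafilter X} {R : ℝ} {F G : ℝ → ℝ}

theorem Ultrafilter.IsGauge.iterate_convAdd_le (hW : Metric.closedBall 0 R ∈ 𝒲)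
    (hF : 𝒲.IsGauge F) (hG : (𝒲.convAdd 𝒲).IsGauge G) (j : ℕ) :
    G^[j] 0 ≤ F^[2 * j] 0 + 2 * R := by
  have hW' := closedBall_mem_reflect hW
  have hWW := closedBall_mem_convAdd hW hW
  have hWW' := closedBall_mem_convAdd hW' hW'
  have hP := closedBall_mem_convAdd hW hW'
  have hQ := closedBall_mem_convAdd hW' hW
  have hlip : ∀ {H : ℝ → ℝ}, LipschitzWith 1 H → ∀ n : ℕ,
      LipschitzWith 1 (H^[n] ∘ (norm : X → ℝ)) := fun hH n => by
    simpa using (hH.iterate n).comp lipschitzWith_one_norm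
  have hGs : ∀ n, G^[n + 1] ∘ (norm : X → ℝ) = shiftLim 𝒲.reflect (shiftLim 𝒲.reflect
      (shiftLim 𝒲 (shiftLim 𝒲 (G^[n] ∘ norm)))) := by
    intro n
    have hl := hlip hG.lipschitz n
    rw [← shiftLim_convAdd hW hW hl, ← shiftLim_convAdd hW' hW' (lipschitzWith_shiftLim hWW hl),
      ← _root_.reflect_convAdd, ← shiftLim_convAdd (closedBall_mem_reflect hWW) hWW hl,
      shiftLim_comp (closedBall_mem_convAdd (closedBall_mem_reflect hWW) hWW)
        lipschitzWith_one_norm (hG.lipschitz.iterate n).continuous, hG.reflect_convAdd,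
      Function.iterate_succ, Function.comp_assoc]
  have hFs : ∀ n, F^[n + 2] ∘ (norm : X → ℝ) = shiftLim (𝒲.convAdd 𝒲.reflect)
      (shiftLim (𝒲.reflect.convAdd 𝒲) (F^[n] ∘ norm)) := by
    intro n
    rw [shiftLim_comp hQ lipschitzWith_one_norm (hF.lipschitz.iterate n).continuous,
      hF.reflect_convAdd, ← Function.comp_assoc, ← Function.iterate_succ,
      shiftLim_comp hP lipschitzWith_one_norm (hF.lipschitz.iterate (n + 1)).continuous,
      hF.convAdd_reflect, ← Function.comp_assoc, ← Function.iterate_succ]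
  have key : ∀ n, ∀ u : X, shiftLim 𝒲 (G^[n] ∘ norm) u ≤ (F^[2 * n] ∘ norm) u + R := by
    intro n
    induction n with
    | zero => exact fun u => shiftLim_le_self_add hW lipschitzWith_one_norm u
    | succ n ih =>
      intro u
      have hl := hlip hG.lipschitz n
      have hlF := hlip hF.lipschitz (2 * n)
      have l1 := lipschitzWith_shiftLim hW hl
      have l2 := lipschitzWith_shiftLim hW l1
      have l3 := lipschitzWith_shiftLim hW' l2
      rw [hGs, ← shiftLim_convAdd hW hW' l3, ← shiftLim_convAdd hW' hW l1,
        show 2 * (n + 1) = 2 * n + 2 by ring, hFs]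
      exact shiftLim_le_add hP (lipschitzWith_shiftLim hQ l1) (lipschitzWith_shiftLim hQ hlF)
        fun x => shiftLim_le_add hQ l1 hlF fun y => ih _
  have h1 := self_le_shiftLim_add hW (hlip hG.lipschitz j) (0 : X)
  have h2 := key j 0
  simp only [Function.comp_apply, norm_zero] at h1 h2
  linarith

end GaugeIteration

section Gauge

variable {X : Type*} [NormedAddCommGroup X] [NormedSpace ℝ X]

/-- A decreasing bounded sequence of convex sets on which every functional is eventually almost
constant. -/
structure IsWeaklyShrinking (C : ℕ → Set X) (R : ℝ) : Prop where
  convex : ∀ k, Convex ℝ (C k)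
  antitone : Antitone C
  norm_le : ∀ k, ∀ x ∈ C k, ‖x‖ ≤ R
  oscillation : ∀ (g : X →L[ℝ] ℝ), ∀ ε > 0, ∃ k, ∀ x ∈ C k, ∀ y ∈ C k, |g x - g y| < ε

/-- The ultrafilter `𝒲` contains the dilates by `a` of all the sets `C k`. -/
def Ultrafilter.IsCarriedBy (𝒲 : Ultrafilter X) (C : ℕ → Set X) (a : ℝ) : Prop :=
  ∀ k, ∀ᶠ w in (𝒲 : Filter X), ∃ x ∈ C k, w = a • x

variable {𝒲 𝒱 : Ultrafilter X} {C : ℕ → Set X} {R a b : ℝ} {F : ℝ → ℝ}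

theorem Ultrafilter.IsCarriedBy.closedBall_mem (h : 𝒲.IsCarriedBy C a) (ha : 0 ≤ a)
    (hC : IsWeaklyShrinking C R) : Metric.closedBall 0 (a * R) ∈ 𝒲 := by
  filter_upwards [h 0]
  rintro w ⟨x, hx, rfl⟩
  rw [mem_closedBall_zero_iff, norm_smul, Real.norm_of_nonneg ha]
  exact mul_le_mul_of_nonneg_left (hC.norm_le 0 x hx) ha

theorem Ultrafilter.IsCarriedBy.convAdd (h : 𝒲.IsCarriedBy C a) (h' : 𝒱.IsCarriedBy C b)
    (ha : 0 < a) (hb : 0 < b) (hC : ∀ k, Convex ℝ (C k)) :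
    (𝒲.convAdd 𝒱).IsCarriedBy C (a + b) := by
  intro k
  rw [Ultrafilter.eventually_convAdd]
  filter_upwards [h k]
  rintro _ ⟨x, hx, rfl⟩
  filter_upwards [h' k]
  rintro _ ⟨y, hy, rfl⟩
  have hab : 0 < a + b := add_pos ha hb
  refine ⟨(a / (a + b)) • x + (b / (a + b)) • y, hC k hx hy (by positivity) (by positivity)
    (by field_simp), ?_⟩
  rw [smul_add, smul_smul, smul_smul, mul_div_cancel₀ _ hab.ne', mul_div_cancel₀ _ hab.ne']

theorem Ultrafilter.IsCarriedBy.eventually_sub (h : 𝒲.IsCarriedBy C a) (k : ℕ) :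
    ∀ᶠ z in (𝒲.convAdd 𝒲.reflect : Filter X), ∃ x ∈ C k, ∃ y ∈ C k, z = a • (x - y) := by
  rw [Ultrafilter.eventually_convAdd]
  filter_upwards [h k]
  rintro _ ⟨x, hx, rfl⟩
  rw [Ultrafilter.eventually_reflect]
  filter_upwards [h k]
  rintro _ ⟨y, hy, rfl⟩
  exact ⟨x, hx, y, hy, by rw [smul_sub, sub_eq_add_neg]⟩

theorem IsWeaklyShrinking.weakNull (hC : IsWeaklyShrinking C R) {z : ℕ → X}
    (hz : ∀ k, ∃ x ∈ C k, ∃ y ∈ C k, z k = a • (x - y)) : WeakNull z := by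
  intro g
  rw [Metric.tendsto_atTop]
  intro ε hε
  obtain ⟨k, hk⟩ := hC.oscillation g (ε / (|a| + 1)) (by positivity)
  refine ⟨k, fun n hn => ?_⟩
  obtain ⟨x, hx, y, hy, hxy⟩ := hz n
  have h1 := hk x (hC.antitone hn hx) y (hC.antitone hn hy)
  rw [hxy, map_smul, map_sub, smul_eq_mul, dist_zero_right, Real.norm_eq_abs, abs_mul]
  rw [lt_div_iff₀ (by positivity)] at h1
  nlinarith [abs_nonneg a, abs_nonneg (g x - g y)]

theorem PropertyM.shiftLim_norm_le (hM : PropertyM X) {𝒴 : Ultrafilter X}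
    (hY : Metric.closedBall 0 R ∈ 𝒴) {D : ℕ → X → Prop}
    (hD : ∀ k, ∀ᶠ z in (𝒴 : Filter X), D k z) (hw : ∀ z : ℕ → X, (∀ k, D k (z k)) → WeakNull z)
    {u v : X} (huv : ‖u‖ ≤ ‖v‖) : shiftLim 𝒴 norm u ≤ shiftLim 𝒴 norm v := by
  have hex : ∀ k : ℕ, ∃ z, D k z ∧ dist ‖u + z‖ (shiftLim 𝒴 norm u) < 1 / ((k : ℝ) + 1) ∧
      dist ‖v + z‖ (shiftLim 𝒴 norm v) < 1 / ((k : ℝ) + 1) := by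
    intro k
    have hk : 0 < 1 / ((k : ℝ) + 1) := by positivity
    exact ((hD k).and
      ((Metric.tendsto_nhds.1 (tendsto_shiftLim hY lipschitzWith_one_norm u) _ hk).and
        (Metric.tendsto_nhds.1 (tendsto_shiftLim hY lipschitzWith_one_norm v) _ hk))).exists
  choose z hz hu hv using hex
  have hlim : ∀ w : X, (∀ k : ℕ, dist ‖w + z k‖ (shiftLim 𝒴 norm w) < 1 / ((k : ℝ) + 1)) →
      Tendsto (fun k => ‖z k + w‖) atTop (𝓝 (shiftLim 𝒴 norm w)) := by
    intro w h
    rw [tendsto_iff_dist_tendsto_zero]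
    refine squeeze_zero (fun _ => dist_nonneg) (fun k => ?_)
      tendsto_one_div_add_atTop_nhds_zero_nat
    rw [add_comm]
    exact (h k).le
  rw [← (hlim u hu).limsup_eq, ← (hlim v hv).limsup_eq]
  exact hM z (hw z hz) u v huv

theorem PropertyM.exists_isGauge [Nontrivial X] (hM : PropertyM X)
    (hC : IsWeaklyShrinking C R) (h : 𝒲.IsCarriedBy C a) (ha : 0 ≤ a) :
    ∃ F, 𝒲.IsGauge F := by
  have hW := h.closedBall_mem ha hC
  have hY := closedBall_mem_convAdd hW (closedBall_mem_reflect hW)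
  have hmono : ∀ {u v : X}, ‖u‖ ≤ ‖v‖ → shiftLim (𝒲.convAdd 𝒲.reflect) norm u ≤
      shiftLim (𝒲.convAdd 𝒲.reflect) norm v :=
    fun huv => hM.shiftLim_norm_le hY h.eventually_sub (fun z hz => hC.weakNull hz) huv
  have heq : ∀ {u v : X}, ‖u‖ = ‖v‖ → shiftLim (𝒲.convAdd 𝒲.reflect) norm u =
      shiftLim (𝒲.convAdd 𝒲.reflect) norm v :=
    fun huv => le_antisymm (hmono huv.le) (hmono huv.ge)
  obtain ⟨e, he⟩ := exists_norm_eq X zero_le_one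
  have hes : ∀ s : ℝ, ‖s • e‖ = |s| := fun s => by rw [norm_smul, he, mul_one, Real.norm_eq_abs]
  have hP : shiftLim (𝒲.convAdd 𝒲.reflect) norm =
      (fun s : ℝ => shiftLim (𝒲.convAdd 𝒲.reflect) norm (s • e)) ∘ norm := by
    ext u
    exact heq (by rw [hes, abs_norm])
  refine ⟨fun s => shiftLim (𝒲.convAdd 𝒲.reflect) norm (s • e), hP, ?_, ?_, fun s => ?_, ?_⟩
  · rw [← hP]
    ext u
    have h1 : (𝒲.reflect.convAdd 𝒲) = (𝒲.convAdd 𝒲.reflect).reflect := by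
      rw [_root_.reflect_convAdd]
      congr 1
      refine Ultrafilter.ext fun s => ?_
      change _ ↔ ∀ᶠ z in (𝒲.reflect.reflect : Filter X), z ∈ s
      simp only [Ultrafilter.eventually_reflect, neg_neg]
      rfl
    rw [h1, ← neg_neg u, shiftLim_reflect_norm_neg hY]
    exact heq (by simp)
  · have h1 : LipschitzWith 1 (fun s : ℝ => s • e) := by
      refine LipschitzWith.of_dist_le_mul fun s t => ?_
      rw [dist_eq_norm, ← sub_smul, hes, NNReal.coe_one, one_mul, Real.dist_eq]
    have h2 := (lipschitzWith_shiftLim hY lipschitzWith_one_norm).comp h1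
    rw [mul_one] at h2
    exact h2
  · exact ge_of_tendsto' (tendsto_shiftLim hY lipschitzWith_one_norm _) fun _ => norm_nonneg _
  · intro s hs t ht hst
    refine hmono ?_
    rwa [hes, hes, abs_of_nonneg hs, abs_of_nonneg ht]

/-- Repeated doubling of an ultrafilter produces gauges controlled by iterates of the first one. -/
theorem PropertyM.exists_isGauge_doubling [Nontrivial X] (hM : PropertyM X)
    (hC : IsWeaklyShrinking C R) (h : 𝒲.IsCarriedBy C 1) (hF : 𝒲.IsGauge F) (i : ℕ) :
    ∃ (𝒱 : Ultrafilter X) (G : ℝ → ℝ), 𝒱.IsCarriedBy C (2 ^ i) ∧ 𝒱.IsGauge G ∧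
      ∀ j, G^[j] 0 ≤ F^[2 ^ i * j] 0 + 2 * R * (2 ^ i - 1) := by
  induction i with
  | zero => exact ⟨𝒲, F, by simpa using h, hF, fun j => by simp⟩
  | succ i ih =>
    obtain ⟨𝒱, G, hV, hG, hGF⟩ := ih
    have hp : (0 : ℝ) < 2 ^ i := by positivity
    have hV2 := hV.convAdd hV hp hp hC.convex
    rw [show (2 : ℝ) ^ i + 2 ^ i = 2 ^ (i + 1) by ring] at hV2
    obtain ⟨H, hH⟩ := hM.exists_isGauge hC hV2 (by positivity)
    refine ⟨_, H, hV2, hH, fun j => ?_⟩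
    have h1 := hG.iterate_convAdd_le (hV.closedBall_mem hp.le hC) hH j
    have h2 := hGF (2 * j)
    rw [show 2 ^ i * (2 * j) = 2 ^ (i + 1) * j by ring] at h2
    rw [pow_succ (2 : ℝ) i]
    linarith

end Gauge

section Dichotomy

theorem iterate_le_add_mul {F : ℝ → ℝ} (hL : LipschitzWith 1 F) (h0 : ∀ s, 0 ≤ F s)
    (hm : MonotoneOn F (Set.Ici 0)) {s c : ℝ} (hs : 0 ≤ s) (hc : 0 ≤ c) (hF : F s ≤ s + c)
    (n : ℕ) : F^[n] 0 ≤ s + n * c := by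
  induction n with
  | zero => simpa using hs
  | succ n ih =>
    rw [Function.iterate_succ_apply']
    have hx : 0 ≤ F^[n] 0 := by
      cases n with
      | zero => simp
      | succ n => rw [Function.iterate_succ_apply']; exact h0 _
    have hnc : 0 ≤ n * c := by positivity
    push_cast
    rcases le_total (F^[n] 0) s with h | h
    · have := hm hx hs h
      linarith
    · have h1 := hL.le_add_mul (F^[n] 0) s
      rw [NNReal.coe_one, one_mul, Real.dist_eq, abs_of_nonneg (sub_nonneg.2 h)] at h1
      linarith

theorem min_le_iterate {G : ℝ → ℝ} (hL : LipschitzWith 1 G) (h0 : ∀ s, 0 ≤ G s)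
    (hm : MonotoneOn G (Set.Ici 0)) {t c : ℝ} (ht : 0 ≤ t) (hc : 0 ≤ c) (hG : t + c ≤ G t)
    (n : ℕ) : min t (n * c) ≤ G^[n] 0 := by
  induction n with
  | zero => simp
  | succ n ih =>
    rw [Function.iterate_succ_apply']
    have hx : 0 ≤ G^[n] 0 := by
      cases n with
      | zero => simp
      | succ n => rw [Function.iterate_succ_apply']; exact h0 _
    push_cast
    rcases le_total (G^[n] 0) t with h | h
    · have h1 := hL.le_add_mul t (G^[n] 0)
      rw [NNReal.coe_one, one_mul, Real.dist_eq, abs_of_nonneg (sub_nonneg.2 h)] at h1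
      rcases min_le_iff.1 ih with h2 | h2
      · exact min_le_iff.2 (Or.inl (by linarith))
      · exact min_le_iff.2 (Or.inr (by linarith))
    · have := hm ht hx h
      exact min_le_iff.2 (Or.inl (by linarith))

variable {X : Type*} [NormedAddCommGroup X] [NormedSpace ℝ X]
variable {𝒲 𝒱 : Ultrafilter X} {C : ℕ → Set X} {R : ℝ}

theorem Ultrafilter.IsGauge.exists_lt_add_of_not_embedsIso_ell1 [CompleteSpace X] {F : ℝ → ℝ}
    (hF : 𝒲.IsGauge F) (hW : Metric.closedBall 0 R ∈ 𝒲)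
    (hl : ¬ EmbedsIso (lp (fun _ : ℕ => ℝ) 1) X) {c : ℝ} (hc : 0 < c) :
    ∃ s, 0 ≤ s ∧ F s < s + c := by
  by_contra! hcon
  have hP := closedBall_mem_convAdd hW (closedBall_mem_reflect hW)
  refine hl (embedsIso_ell1_of_filter (𝒲.convAdd 𝒲.reflect : Filter X) hc hP fun u ε hε => ?_)
  refine (tendsto_shiftLim hP lipschitzWith_one_norm u).eventually_const_lt ?_
  rw [hF.convAdd_reflect, Function.comp_apply]
  linarith [hcon _ (norm_nonneg u)]

/-- A space with Property (M) which has a weakly shrinking, but norm separated, sequence of convex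
sets contains `ℓ₁` or `c₀`. -/
theorem PropertyM.embedsIso_c0_of_isWeaklyShrinking [CompleteSpace X] [Nontrivial X]
    (hM : PropertyM X) (hl : ¬ EmbedsIso (lp (fun _ : ℕ => ℝ) 1) X)
    (hC : IsWeaklyShrinking C R) (hW : 𝒲.IsCarriedBy C 1) {δ : ℝ} (hδ : 0 < δ)
    (hsep : ∀ x, ∃ k, ∀ y ∈ C k, δ ≤ ‖x - y‖) : EmbedsIso C₀(ℕ, ℝ) X := by
  obtain ⟨F, hF⟩ := hM.exists_isGauge hC hW zero_le_one
  have hR : 0 ≤ R := by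
    obtain ⟨_, x, hx, -⟩ := (hW 0).exists
    exact (norm_nonneg x).trans (hC.norm_le 0 x hx)
  refine embedsIso_c0_of_filter (R := 2 * R) (B := 2 * R + 2) hδ (by linarith) fun η hη => ?_
  obtain ⟨j, hj⟩ := exists_nat_gt ((2 * R + 2) / η)
  rw [div_lt_iff₀ hη] at hj
  have hj0 : (0 : ℝ) < j := by
    by_contra! h
    nlinarith
  obtain ⟨s, hs0, hs⟩ := hF.exists_lt_add_of_not_embedsIso_ell1 (hW.closedBall_mem zero_le_one hC)
    hl (c := 1 / (2 * j)) (by positivity)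
  obtain ⟨i, hi⟩ := pow_unbounded_of_one_lt (2 * s) (one_lt_two (α := ℝ))
  obtain ⟨𝒱, G, hV, hG, hGF⟩ := hM.exists_isGauge_doubling hC hW hF i
  have hp : (0 : ℝ) < 2 ^ i := by positivity
  have hGT : G (2 ^ i * (2 * R + 2)) < 2 ^ i * (2 * R + 2) + 2 ^ i * η := by
    by_contra! hcon
    have h1 := min_le_iterate hG.lipschitz hG.nonneg hG.monotone (by positivity) (by positivity)
      hcon j
    have h2 := hGF j
    have h3 := iterate_le_add_mul hF.lipschitz hF.nonneg hF.monotone hs0 (by positivity) hs.le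
      (2 ^ i * j)
    have h4 : ((2 ^ i * j : ℕ) : ℝ) * (1 / (2 * j)) = 2 ^ i / 2 := by
      push_cast
      field_simp
    rw [min_eq_left (by nlinarith)] at h1
    nlinarith
  have hGu : ∀ t, 0 ≤ t → G (2 ^ i * t) < 2 ^ i * (max t (2 * R + 2) + η) := by
    intro t ht
    rcases le_total t (2 * R + 2) with h | h
    · have := hG.monotone (Set.mem_Ici.2 (by positivity)) (Set.mem_Ici.2 (by positivity))
        (mul_le_mul_of_nonneg_left h hp.le)
      rw [max_eq_right h]
      linarith
    · have h1 := hG.lipschitz.le_add_mul (2 ^ i * t) (2 ^ i * (2 * R + 2))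
      rw [NNReal.coe_one, one_mul, Real.dist_eq,
        abs_of_nonneg (by nlinarith)] at h1
      rw [max_eq_left h]
      linarith
  have hVb := hV.closedBall_mem hp.le hC
  have hP := closedBall_mem_convAdd hVb (closedBall_mem_reflect hVb)
  have hscale : ∀ x : X, (2 ^ i : ℝ)⁻¹ • (2 ^ i : ℝ) • x = x := fun x =>
    inv_smul_smul₀ hp.ne' x
  refine ⟨map (fun z => (2 ^ i : ℝ)⁻¹ • z) (𝒱.convAdd 𝒱.reflect : Filter X), inferInstance, ?_, ?_,
    fun g => ?_, fun u => ?_⟩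
  · rw [mem_map]
    filter_upwards [hV.eventually_sub 0]
    rintro _ ⟨x, hx, y, hy, rfl⟩
    rw [Set.mem_preimage, hscale, mem_closedBall_zero_iff]
    linarith [norm_sub_le x y, hC.norm_le 0 x hx, hC.norm_le 0 y hy]
  · rw [eventually_map, Ultrafilter.eventually_convAdd]
    filter_upwards [hV 0]
    rintro _ ⟨x, -, rfl⟩
    obtain ⟨k, hk⟩ := hsep x
    rw [Ultrafilter.eventually_reflect]
    filter_upwards [hV k]
    rintro _ ⟨y, hy, rfl⟩
    rw [← sub_eq_add_neg, ← smul_sub, hscale]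
    exact hk y hy
  · rw [Metric.tendsto_nhds]
    intro ε hε
    obtain ⟨k, hk⟩ := hC.oscillation g ε hε
    rw [eventually_map]
    filter_upwards [hV.eventually_sub k]
    rintro _ ⟨x, hx, y, hy, rfl⟩
    rw [hscale, map_sub, dist_zero_right, Real.norm_eq_abs]
    exact hk x hx y hy
  · rw [eventually_map]
    have h1 := tendsto_shiftLim hP lipschitzWith_one_norm ((2 ^ i : ℝ) • u)
    rw [hG.convAdd_reflect, Function.comp_apply, norm_smul, Real.norm_of_nonneg hp.le] at h1
    filter_upwards [h1.eventually_lt_const (hGu _ (norm_nonneg u))] with z hz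
    have h2 : u + (2 ^ i : ℝ)⁻¹ • z = (2 ^ i : ℝ)⁻¹ • ((2 ^ i : ℝ) • u + z) := by
      rw [smul_add, hscale]
    rwa [h2, norm_smul, norm_inv, Real.norm_of_nonneg hp.le, inv_mul_lt_iff₀ hp]

end Dichotomy

section WeaklyCauchy

variable {X : Type*} [NormedAddCommGroup X] [NormedSpace ℝ X]

theorem PropertyM.embedsIso_c0_of_weaklyCauchy [CompleteSpace X] (hM : PropertyM X)
    (hl : ¬ EmbedsIso (lp (fun _ : ℕ => ℝ) 1) X) {w : ℕ → X} {R : ℝ} (hw : ∀ n, ‖w n‖ ≤ R)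
    (hcau : ∀ g : X →L[ℝ] ℝ, ∃ l, Tendsto (fun n => g (w n)) atTop (𝓝 l))
    {f : ℕ → X →L[ℝ] ℝ} (hf : ∀ i, ‖f i‖ ≤ 1) (hf0 : WeakStarNull f) {d : ℝ} (hd : 0 < d)
    (hfd : ∀ i n, i ≤ n → d ≤ f i (w n)) : EmbedsIso C₀(ℕ, ℝ) X := by
  have hX : Nontrivial X := by
    refine ⟨w 0, 0, fun h => ?_⟩
    have := hfd 0 0 le_rfl
    rw [h, map_zero] at this
    linarith
  have hC : IsWeaklyShrinking (fun k => convexHull ℝ (w '' Set.Ici k)) R := by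
    refine ⟨fun k => convex_convexHull ℝ _, fun k l hkl => convexHull_mono
      (Set.image_mono (Set.Ici_subset_Ici.2 hkl)), fun k x hx => ?_, fun g ε hε => ?_⟩
    · refine mem_closedBall_zero_iff.1 (convexHull_min ?_ (convex_closedBall 0 R) hx)
      rintro _ ⟨n, -, rfl⟩
      exact mem_closedBall_zero_iff.2 (hw n)
    · obtain ⟨l, hlim⟩ := hcau g
      obtain ⟨k, hk⟩ := Metric.tendsto_atTop.1 hlim _ (half_pos hε)
      have hsub : convexHull ℝ (w '' Set.Ici k) ⊆ g ⁻¹' Metric.ball l (ε / 2) := by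
        refine convexHull_min ?_ ((convex_ball l (ε / 2)).linear_preimage g.toLinearMap)
        rintro _ ⟨n, hn, rfl⟩
        exact hk n hn
      refine ⟨k, fun x hx y hy => ?_⟩
      rw [← Real.dist_eq]
      exact (dist_triangle_right _ _ l).trans_lt
        ((add_lt_add (hsub hx) (hsub hy)).trans_eq (add_halves ε))
  refine hM.embedsIso_c0_of_isWeaklyShrinking (𝒲 := Ultrafilter.of (map w atTop)) hl hC
    (fun k => ?_) (half_pos hd) fun x => ?_
  · refine Ultrafilter.of_le _ ?_
    rw [mem_map]
    filter_upwards [eventually_ge_atTop k] with n hn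
    exact ⟨w n, subset_convexHull ℝ _ ⟨n, hn, rfl⟩, (one_smul ℝ _).symm⟩
  · obtain ⟨i, hi⟩ := ((hf0 x).eventually_lt_const (half_pos hd)).exists
    refine ⟨i, fun y hy => ?_⟩
    have h1 : d ≤ f i y := by
      have hsub : convexHull ℝ (w '' Set.Ici i) ⊆ f i ⁻¹' Set.Ici d := by
        refine convexHull_min ?_ ((convex_Ici d).linear_preimage (f i).toLinearMap)
        rintro _ ⟨n, hn, rfl⟩
        exact hfd i n hn
      exact hsub hy
    have h2 : f i (y - x) ≤ ‖y - x‖ :=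
      (le_abs_self _).trans (((f i).le_opNorm _).trans
        (mul_le_of_le_one_left (norm_nonneg _) (hf i)))
    rw [map_sub] at h2
    rw [norm_sub_rev]
    linarith

end WeaklyCauchy

section Rosenthal

theorem exists_seq_forall_rel {α : Type*} (r : ℕ → α → α → Prop) (h : ∀ n a, ∃ b, r n a b)
    (a : α) : ∃ f : ℕ → α, f 0 = a ∧ ∀ n, r n (f n) (f (n + 1)) := by
  choose g hg using h
  exact ⟨fun n => Nat.rec a (fun k b => g k b) n, rfl, fun n => hg n _⟩

theorem strictMono_and_mem_of_shrinking {L : ℕ → Set ℕ} {m : ℕ → ℕ} (hm : ∀ i, m i ∈ L i)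
    (hL : ∀ i, L (i + 1) ⊆ L i ∩ Set.Ioi (m i)) :
    StrictMono m ∧ ∀ i j, i ≤ j → m j ∈ L i := by
  have hanti : Antitone L := antitone_nat_of_succ_le fun i => (hL i).trans Set.inter_subset_left
  exact ⟨strictMono_nat_of_lt_succ fun i => (hL i (hm (i + 1))).2,
    fun i j hij => hanti hij (hm j)⟩

variable {S : Type*}

/-- Along `M`, no point of `E` lies infinitely often in both families `V true` and `V false`. -/
def SettlesOn (V : Bool → ℕ → Set S) (E : Set S) (M : Set ℕ) : Prop :=
  ∀ s ∈ E, ∃ b, {n ∈ M | s ∈ V b n}.Finite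

/-- No infinite subset of `L` settles on `E`. -/
def NeverSettlesOn (V : Bool → ℕ → Set S) (E : Set S) (L : Set ℕ) : Prop :=
  ∀ M ⊆ L, M.Infinite → ¬ SettlesOn V E M

variable {V : Bool → ℕ → Set S} {E : Set S} {L M : Set ℕ}

theorem SettlesOn.of_diff_finite (h : SettlesOn V E M) (hL : (L \ M).Finite) :
    SettlesOn V E L := by
  intro s hs
  obtain ⟨b, hb⟩ := h s hs
  refine ⟨b, (hb.union hL).subset fun n hn => ?_⟩
  by_cases hnM : n ∈ M
  · exact Or.inl ⟨hnM, hn.2⟩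
  · exact Or.inr ⟨hn.1, hnM⟩

theorem range_diff_finite {L : ℕ → Set ℕ} {m : ℕ → ℕ} (h : ∀ i j, i ≤ j → m j ∈ L i) (i : ℕ)
    (I : Set ℕ) : (m '' I \ L i).Finite := by
  refine ((Set.finite_Iio i).image m).subset ?_
  rintro _ ⟨⟨j, -, rfl⟩, hj⟩
  exact ⟨j, not_le.1 fun hij => hj (h i j hij), rfl⟩

theorem exists_neverSettlesOn_inter {𝓔 : Set (Set S)} (h𝓔 : 𝓔.Finite) (hL : L.Infinite)
    (h : ∀ E ∈ 𝓔, NeverSettlesOn V E L) :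
    ∃ m ∈ L, ∃ L' ⊆ L ∩ Set.Ioi m, L'.Infinite ∧
      ∀ E ∈ 𝓔, ∀ b, NeverSettlesOn V (E ∩ V b m) L' := by
  by_contra! hcon
  have hstep : ∀ (_ : ℕ) (K : {K : Set ℕ // K.Infinite ∧ K ⊆ L}),
      ∃ K' : {K : Set ℕ // K.Infinite ∧ K ⊆ L}, ∃ m ∈ K.1, K'.1 ⊆ K.1 ∩ Set.Ioi m ∧
        ∃ p ∈ 𝓔 ×ˢ (Set.univ : Set Bool), SettlesOn V (p.1 ∩ V p.2 m) K'.1 := by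
    rintro - ⟨K, hK, hKL⟩
    obtain ⟨m, hm⟩ := hK.nonempty
    have hK' : (K ∩ Set.Ioi m).Infinite := by
      have h1 := hK.sdiff (Set.finite_Iic m)
      rwa [Set.sdiff_eq, Set.compl_Iic] at h1
    obtain ⟨E, hE, b, hEb⟩ := hcon m (hKL hm) (K ∩ Set.Ioi m)
      (Set.inter_subset_inter_left _ hKL) hK'
    unfold NeverSettlesOn at hEb
    push Not at hEb
    obtain ⟨M, hMK, hM, hset⟩ := hEb
    exact ⟨⟨M, hM, (hMK.trans Set.inter_subset_left).trans hKL⟩, m, hm, hMK, (E, b),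
      ⟨hE, Set.mem_univ _⟩, hset⟩
  obtain ⟨K, -, hK⟩ := exists_seq_forall_rel _ hstep ⟨L, hL, subset_rfl⟩
  choose m hm hsub p hp hset using hK
  obtain ⟨hmono, hmem⟩ := strictMono_and_mem_of_shrinking (L := fun i => (K i).1) hm hsub
  obtain ⟨q, hq, hinf⟩ : ∃ q ∈ 𝓔 ×ˢ (Set.univ : Set Bool), {i | p i = q}.Infinite := by
    by_contra! hfin
    have h1 := (h𝓔.prod Set.finite_univ).biUnion (t := fun q => {i | p i = q}) fun q hq =>
      hfin q hq
    refine Set.infinite_univ (h1.subset fun i _ => ?_)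
    exact Set.mem_iUnion₂.2 ⟨p i, hp i, rfl⟩
  refine h q.1 hq.1 (m '' {i | p i = q}) ?_ (hinf.image hmono.injective.injOn) ?_
  · rintro _ ⟨i, -, rfl⟩
    exact (K i).2.2 (hm i)
  · intro s hs
    by_cases hex : ∃ i, p i = q ∧ s ∈ V q.2 (m i)
    · obtain ⟨i, rfl, hsi⟩ := hex
      exact (hset i).of_diff_finite (range_diff_finite hmem (i + 1) _) s ⟨hs, hsi⟩
    · refine ⟨q.2, Set.finite_empty.subset ?_⟩
      rintro _ ⟨⟨i, hi, rfl⟩, hsi⟩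
      exact hex ⟨i, hi, hsi⟩

/-- If no subsequence settles, some subsequence is independent. -/
theorem NeverSettlesOn.exists_independent (hL : L.Infinite)
    (h : NeverSettlesOn V Set.univ L) :
    ∃ m : ℕ → ℕ, ∀ (k : ℕ) (σ : ℕ → Bool), ∃ s, ∀ i < k, s ∈ V (σ i) (m i) := by
  have hstep : ∀ (_ : ℕ) (K : {K : Set (Set S) × Set ℕ // K.1.Finite ∧ K.2.Infinite ∧
      ∀ E ∈ K.1, NeverSettlesOn V E K.2}),
      ∃ K' : {K : Set (Set S) × Set ℕ // K.1.Finite ∧ K.2.Infinite ∧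
        ∀ E ∈ K.1, NeverSettlesOn V E K.2}, ∃ m : ℕ,
          ∀ E ∈ K.1.1, ∀ b, E ∩ V b m ∈ K'.1.1 := by
    rintro - ⟨⟨𝓔, K⟩, h𝓔, hK, hE⟩
    obtain ⟨m, -, L', -, hL', hm⟩ := exists_neverSettlesOn_inter h𝓔 hK hE
    refine ⟨⟨⟨(fun p : Set S × Bool => p.1 ∩ V p.2 m) '' (𝓔 ×ˢ Set.univ), L'⟩,
      (h𝓔.prod Set.finite_univ).image _, hL', ?_⟩, m, fun E hE b =>
        ⟨(E, b), ⟨hE, Set.mem_univ _⟩, rfl⟩⟩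
    rintro _ ⟨⟨E, b⟩, ⟨hE, -⟩, rfl⟩
    exact hm E hE b
  obtain ⟨K, hK0, hK⟩ := exists_seq_forall_rel _ hstep
    ⟨⟨{Set.univ}, L⟩, Set.finite_singleton _, hL, by
      rintro E rfl
      exact h⟩
  choose m hm using hK
  refine ⟨m, fun k σ => ?_⟩
  have hmem : {s | ∀ i < k, s ∈ V (σ i) (m i)} ∈ (K k).1.1 := by
    induction k with
    | zero => simp [hK0]
    | succ k ih =>
      convert hm k _ ih (σ k) using 1
      ext s
      simp only [Set.mem_ofPred_eq, Set.mem_inter_iff, Nat.lt_succ_iff_lt_or_eq]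
      constructor
      · exact fun hs => ⟨fun i hi => hs i (Or.inl hi), hs k (Or.inr rfl)⟩
      · rintro ⟨h1, h2⟩ i (hi | rfl)
        · exact h1 i hi
        · exact h2
  by_contra hemp
  refine (K k).2.2.2 _ hmem (K k).1.2 subset_rfl (K k).2.2.1 fun s hs => ?_
  exact (hemp ⟨s, hs⟩).elim

theorem exists_strictMono_settlesOn {ι : Type*} [Countable ι] [Nonempty ι]
    (W : ι → Bool → ℕ → Set S)
    (h : ∀ i, ∀ L : Set ℕ, L.Infinite → ¬ NeverSettlesOn (W i) Set.univ L) :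
    ∃ φ : ℕ → ℕ, StrictMono φ ∧ ∀ i, SettlesOn (W i) Set.univ (Set.range φ) := by
  obtain ⟨e, he⟩ := exists_surjective_nat ι
  have hstep : ∀ (n : ℕ) (K : {K : Set ℕ // K.Infinite}), ∃ K' : {K : Set ℕ // K.Infinite},
      ∃ m ∈ K.1, K'.1 ⊆ K.1 ∩ Set.Ioi m ∧ SettlesOn (W (e n)) Set.univ K'.1 := by
    rintro n ⟨K, hK⟩
    obtain ⟨m, hm⟩ := hK.nonempty
    have hK' : (K ∩ Set.Ioi m).Infinite := by
      have h1 := hK.sdiff (Set.finite_Iic m)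
      rwa [Set.sdiff_eq, Set.compl_Iic] at h1
    have h2 := h (e n) _ hK'
    unfold NeverSettlesOn at h2
    push Not at h2
    obtain ⟨M, hMK, hM, hset⟩ := h2
    exact ⟨⟨M, hM⟩, m, hm, hMK, hset⟩
  obtain ⟨K, -, hK⟩ := exists_seq_forall_rel _ hstep ⟨Set.univ, Set.infinite_univ⟩
  choose m hm hsub hset using hK
  obtain ⟨hmono, hmem⟩ := strictMono_and_mem_of_shrinking (L := fun i => (K i).1) hm hsub
  refine ⟨m, hmono, fun i => ?_⟩
  obtain ⟨n, rfl⟩ := he i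
  rw [← Set.image_univ]
  exact (hset n).of_diff_finite (range_diff_finite hmem (n + 1) _)

variable {X : Type*} [NormedAddCommGroup X] [NormedSpace ℝ X]

theorem embedsIso_ell1_of_independent [CompleteSpace X] {y : ℕ → X} {R q r : ℝ}
    (hR : ∀ n, ‖y n‖ ≤ R) (hrq : r < q)
    (h : ∀ (k : ℕ) (σ : ℕ → Bool), ∃ f : X →L[ℝ] ℝ, ‖f‖ ≤ 1 ∧
      ∀ i < k, if σ i then q ≤ f (y i) else f (y i) ≤ r) :
    EmbedsIso (lp (fun _ : ℕ => ℝ) 1) X := by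
  refine embedsIso_ell1_of_lower_estimate y (half_pos (sub_pos.2 hrq)) hR fun n a => ?_
  obtain ⟨f, hf, hfa⟩ := h n fun i => decide (0 ≤ a i)
  obtain ⟨g, hg, hga⟩ := h n fun i => !decide (0 ≤ a i)
  have h1 : (q - r) * ∑ i ∈ Finset.range n, |a i| ≤ (f - g) (∑ i ∈ Finset.range n, a i • y i) := by
    rw [map_sum, Finset.mul_sum]
    refine Finset.sum_le_sum fun i hi => ?_
    have h2 := hfa i (Finset.mem_range.1 hi)
    have h3 := hga i (Finset.mem_range.1 hi)
    rw [map_smul, smul_eq_mul, sub_apply]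
    rcases le_or_gt 0 (a i) with ha | ha
    · simp only [ha, decide_true, if_true, Bool.not_true, Bool.false_eq_true, if_false] at h2 h3
      rw [abs_of_nonneg ha]
      nlinarith
    · simp only [not_le.2 ha, decide_false, if_true, Bool.not_false, Bool.false_eq_true,
        if_false] at h2 h3
      rw [abs_of_neg ha]
      nlinarith
  have h4 : (f - g) (∑ i ∈ Finset.range n, a i • y i) ≤
      2 * ‖∑ i ∈ Finset.range n, a i • y i‖ := by
    refine (le_abs_self _).trans (((f - g).le_opNorm _).trans ?_)
    gcongr
    linarith [norm_sub_le f g]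
  linarith

/-- Rosenthal's `ℓ₁` theorem. -/
theorem exists_weaklyCauchy_subseq [CompleteSpace X] {x : ℕ → X} {R : ℝ} (hR : ∀ n, ‖x n‖ ≤ R)
    (hl : ¬ EmbedsIso (lp (fun _ : ℕ => ℝ) 1) X) :
    ∃ φ : ℕ → ℕ, StrictMono φ ∧
      ∀ g : X →L[ℝ] ℝ, ∃ l, Tendsto (fun n => g (x (φ n))) atTop (𝓝 l) := by
  let W : {p : ℚ × ℚ // p.1 < p.2} → Bool → ℕ → Set {f : X →L[ℝ] ℝ // ‖f‖ ≤ 1} :=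
    fun p b n => {f | if b then (p.1.2 : ℝ) < f.1 (x n) else f.1 (x n) < p.1.1}
  have : Nonempty {p : ℚ × ℚ // p.1 < p.2} := ⟨⟨(0, 1), zero_lt_one⟩⟩
  obtain ⟨φ, hφ, hset⟩ := exists_strictMono_settlesOn W (by
    intro p L hL hns
    obtain ⟨m, hm⟩ := hns.exists_independent hL
    refine hl (embedsIso_ell1_of_independent (y := x ∘ m) (fun n => hR _)
      (Rat.cast_lt.2 p.2) fun k σ => ?_)
    obtain ⟨f, hf⟩ := hm k σ
    refine ⟨f.1, f.2, fun i hi => ?_⟩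
    have h1 := hf i hi
    cases hσ : σ i
    · simp only [W, hσ, Set.mem_ofPred_eq, Bool.false_eq_true, if_false] at h1 ⊢
      exact h1.le
    · simp only [W, hσ, Set.mem_ofPred_eq, if_true] at h1 ⊢
      exact h1.le)
  have hball : ∀ f : X →L[ℝ] ℝ, ‖f‖ ≤ 1 → ∃ l, Tendsto (fun n => f (x (φ n))) atTop (𝓝 l) := by
    intro f hf
    have hb : ∀ n, |f (x (φ n))| ≤ R := fun n =>
      (f.le_of_opNorm_le hf _).trans (by simpa using hR _)
    refine tendsto_of_no_upcrossings Rat.denseRange_cast ?_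
      (isBoundedUnder_of ⟨R, fun n => (abs_le.1 (hb n)).2⟩)
      (isBoundedUnder_of ⟨-R, fun n => (abs_le.1 (hb n)).1⟩)
    rintro _ ⟨a, rfl⟩ _ ⟨b, rfl⟩ hab ⟨h1, h2⟩
    rw [Nat.frequently_atTop_iff_infinite] at h1 h2
    obtain ⟨c, hc⟩ := hset ⟨(a, b), Rat.cast_lt.1 hab⟩ ⟨f, hf⟩ (Set.mem_univ _)
    cases c
    · refine (h1.image hφ.injective.injOn) (hc.subset ?_)
      rintro _ ⟨n, hn, rfl⟩
      exact ⟨⟨n, rfl⟩, by simpa [W] using hn⟩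
    · refine (h2.image hφ.injective.injOn) (hc.subset ?_)
      rintro _ ⟨n, hn, rfl⟩
      exact ⟨⟨n, rfl⟩, by simpa [W] using hn⟩
  refine ⟨φ, hφ, fun g => ?_⟩
  have hg : 0 < ‖g‖ + 1 := by positivity
  obtain ⟨l, hlim⟩ := hball ((‖g‖ + 1)⁻¹ • g) (by
    rw [norm_smul, norm_inv, Real.norm_of_nonneg hg.le, inv_mul_le_iff₀ hg]
    linarith)
  refine ⟨(‖g‖ + 1) * l, (hlim.const_mul (‖g‖ + 1)).congr fun n => ?_⟩
  rw [smul_apply, smul_eq_mul, mul_inv_cancel_left₀ hg.ne']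

end Rosenthal

section Bidual

variable {X : Type*} [NormedAddCommGroup X] [NormedSpace ℝ X]

/-- A functional bounded by `b` on the unit ball of a subspace agrees on it with a functional of norm
at most `b`. -/
theorem exists_dual_norm_le_eqOn {p : Subspace ℝ X} {Z : StrongDual ℝ X} {b : ℝ} (hb : 0 ≤ b)
    (h : ∀ f ∈ p, ‖f‖ ≤ 1 → Z f ≤ b) : ∃ Z' : StrongDual ℝ X, ‖Z'‖ ≤ b ∧ ∀ f ∈ p, Z' f = Z f := by
  have h1 : ∀ f ∈ p, Z f ≤ b * ‖f‖ := by
    intro f hf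
    rcases (norm_nonneg f).eq_or_lt with h0 | h0
    · rw [norm_eq_zero.1 h0.symm]
      simp
    · have h2 := h (‖f‖⁻¹ • f) (p.smul_mem _ hf)
        (by rw [norm_smul, norm_inv, norm_norm, inv_mul_cancel₀ h0.ne'])
      rw [map_smul, smul_eq_mul, inv_mul_le_iff₀ h0] at h2
      linarith
  obtain ⟨Z', hZ', hn⟩ := exists_extension_norm_eq p (Z.comp p.subtypeL)
  refine ⟨Z', hn.trans_le (ContinuousLinearMap.opNorm_le_bound _ hb fun f => ?_),
    fun f hf => hZ' ⟨f, hf⟩⟩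
  refine abs_le.2 ⟨?_, h1 f.1 f.2⟩
  have h2 := h1 (-f.1) (p.neg_mem f.2)
  rw [map_neg, norm_neg] at h2
  exact neg_le.1 h2

open NormedSpace in
/-- A functional on the dual at distance at least `d` from `X` is large at some functional of norm
one vanishing on a prescribed finite set. -/
theorem exists_dual_vanishing_of_le_norm_sub {ι : Type*} [Finite ι] {Z : StrongDual ℝ (X →L[ℝ] ℝ)}
    {d : ℝ} (hd : 0 < d) (hZ : ∀ x, d ≤ ‖Z - inclusionInDoubleDual ℝ X x‖) (e : ι → X) :
    ∃ f : X →L[ℝ] ℝ, ‖f‖ ≤ 1 ∧ (∀ i, f (e i) = 0) ∧ d / 2 ≤ Z f := by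
  have := Fintype.ofFinite ι
  by_contra! hcon
  let l : ι → (X →L[ℝ] ℝ) →ₗ[ℝ] ℝ := fun i => (inclusionInDoubleDual ℝ X (e i)).toLinearMap
  let p : Subspace ℝ (X →L[ℝ] ℝ) := ⨅ i, (l i).ker
  obtain ⟨Z', hn, hZ'⟩ := exists_dual_norm_le_eqOn (p := p) (Z := Z) (b := d / 2) (by positivity)
    fun f hf hf1 => (hcon f hf1 fun i => (Submodule.mem_iInf _).1 hf i).le
  have hker : p ≤ (Z - Z').toLinearMap.ker := by
    intro f hf
    rw [LinearMap.mem_ker]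
    change Z f - Z' f = 0
    rw [hZ' f hf, sub_self]
  obtain ⟨c, hc⟩ := (Submodule.mem_span_range_iff_exists_fun ℝ).1 (mem_span_of_iInf_ker_le_ker hker)
  have h1 : Z - inclusionInDoubleDual ℝ X (∑ i, c i • e i) = Z' := by
    ext f
    have h2 := LinearMap.congr_fun hc f
    simp only [LinearMap.sum_apply, LinearMap.smul_apply] at h2
    change ∑ i, c i • f (e i) = Z f - Z' f at h2
    rw [sub_apply, dual_def, map_sum]
    simp only [map_smul]
    linarith
  have h2 := hZ (∑ i, c i • e i)
  rw [h1] at h2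
  linarith

/-- Helly's theorem on approximate interpolation of functionals on the dual. -/
theorem exists_norm_le_forall_lt_apply {ι : Type*} [Finite ι] (Z : StrongDual ℝ (X →L[ℝ] ℝ))
    (f : ι → X →L[ℝ] ℝ) {ε : ℝ} (hε : 0 < ε) :
    ∃ x, ‖x‖ ≤ ‖Z‖ + 1 ∧ ∀ i, Z (f i) - ε < f i x := by
  have := Fintype.ofFinite ι
  classical
  let T : X →ₗ[ℝ] (ι → ℝ) := LinearMap.pi fun i => (f i).toLinearMap
  let K : Set (ι → ℝ) := T '' Metric.closedBall 0 (‖Z‖ + 1)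
  have hmem : (fun i => Z (f i)) ∈ closure K := by
    by_contra hnot
    obtain ⟨φ, u, hu, huZ⟩ := geometric_hahn_banach_closed_point
      (((convex_closedBall (0 : X) (‖Z‖ + 1)).linear_image T).closure) isClosed_closure hnot
    let g : X →L[ℝ] ℝ := ∑ i, φ (Pi.single i 1) • f i
    have hφ : ∀ v : ι → ℝ, φ v = ∑ i, φ (Pi.single i 1) * v i := by
      intro v
      conv_lhs => rw [pi_eq_sum_univ' v]
      rw [map_sum]
      refine Finset.sum_congr rfl fun i _ => ?_
      rw [map_smul, smul_eq_mul, mul_comm]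
    have hg : ∀ x, ‖x‖ ≤ ‖Z‖ + 1 → g x < u := by
      intro x hx
      have h1 := hu (T x) (subset_closure ⟨x, mem_closedBall_zero_iff.2 hx, rfl⟩)
      rw [hφ] at h1
      simpa [g, T] using h1
    have hM : 0 < ‖Z‖ + 1 := by positivity
    have hu0 : 0 < u := by simpa using hg 0 (by simpa using hM.le)
    have hgn : ‖g‖ ≤ u / (‖Z‖ + 1) := by
      refine ContinuousLinearMap.opNorm_le_bound _ (by positivity) fun x => ?_
      rcases (norm_nonneg x).eq_or_lt with h0 | h0
      · rw [norm_eq_zero.1 h0.symm]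
        simp
      · have hs : ‖((‖Z‖ + 1) * ‖x‖⁻¹) • x‖ ≤ ‖Z‖ + 1 := by
          rw [norm_smul, norm_mul, norm_inv, norm_norm, Real.norm_of_nonneg hM.le,
            inv_mul_cancel_right₀ h0.ne']
        have h1 := hg _ hs
        have h2 := hg (-_) ((norm_neg _).trans_le hs)
        rw [map_neg] at h2
        rw [map_smul, smul_eq_mul] at h1 h2
        have h3 : |(‖Z‖ + 1) * ‖x‖⁻¹ * g x| ≤ u := abs_le.2 ⟨by linarith, h1.le⟩
        rw [abs_mul, abs_of_pos (by positivity)] at h3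
        rw [Real.norm_eq_abs, div_mul_eq_mul_div, le_div_iff₀ hM]
        rw [← div_eq_mul_inv, div_mul_eq_mul_div, div_le_iff₀ h0] at h3
        linarith
    have h1 : Z g = φ fun i => Z (f i) := by
      rw [hφ]
      simp [g]
    have h2 : Z g ≤ ‖Z‖ * (u / (‖Z‖ + 1)) :=
      (le_abs_self _).trans (Z.le_opNorm_of_le hgn)
    rw [mul_div_assoc', le_div_iff₀ hM] at h2
    nlinarith [norm_nonneg Z]
  obtain ⟨_, ⟨x, hx, rfl⟩, hdist⟩ := Metric.mem_closure_iff.1 hmem ε hε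
  refine ⟨x, mem_closedBall_zero_iff.1 hx, fun i => ?_⟩
  have h1 := (dist_pi_lt_iff hε).1 hdist i
  rw [Real.dist_eq] at h1
  have h2 := (abs_lt.1 h1).2
  change Z (f i) - f i x < ε at h2
  linarith

theorem weakStarNull_of_forall_denseSeq [TopologicalSpace.SeparableSpace X]
    {f : ℕ → X →L[ℝ] ℝ} (hf : ∀ n, ‖f n‖ ≤ 1)
    (h0 : ∀ n, ∀ i < n, f n (TopologicalSpace.denseSeq X i) = 0) : WeakStarNull f := by
  intro x
  rw [Metric.tendsto_atTop]
  intro ε hε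
  obtain ⟨_, ⟨i, rfl⟩, hi⟩ := Metric.mem_closure_iff.1
    (TopologicalSpace.denseRange_denseSeq X x) ε hε
  refine ⟨i + 1, fun n hn => ?_⟩
  have h1 : f n x = f n (x - TopologicalSpace.denseSeq X i) := by
    rw [map_sub, h0 n i (by omega), sub_zero]
  rw [dist_zero_right, h1]
  refine ((f n).le_of_opNorm_le (hf n) _).trans_lt ?_
  rwa [one_mul, ← dist_eq_norm]

theorem exists_weakStarNull_and_bounded_of_not_isReflexive [CompleteSpace X]
    [TopologicalSpace.SeparableSpace X] (h : ¬ IsReflexive X) :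
    ∃ (f : ℕ → X →L[ℝ] ℝ) (x : ℕ → X) (d R : ℝ), (∀ i, ‖f i‖ ≤ 1) ∧ WeakStarNull f ∧ 0 < d ∧
      (∀ n, ‖x n‖ ≤ R) ∧ ∀ i n, i ≤ n → d ≤ f i (x n) := by
  obtain ⟨Z, hZ⟩ := not_forall.1 h
  have hcl : IsClosed (Set.range (NormedSpace.inclusionInDoubleDual ℝ X)) := by
    have hiso : Isometry (NormedSpace.inclusionInDoubleDual ℝ X) :=
      (NormedSpace.inclusionInDoubleDualLi (E := X) ℝ).isometry
    exact hiso.isClosedEmbedding.isClosed_range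
  have hd := (hcl.notMem_iff_infDist_pos (Set.range_nonempty _)).1 hZ
  have hle : ∀ x, Metric.infDist Z (Set.range (NormedSpace.inclusionInDoubleDual ℝ X)) ≤
      ‖Z - NormedSpace.inclusionInDoubleDual ℝ X x‖ := by
    intro x
    exact (Metric.infDist_le_dist_of_mem (Set.mem_range_self x)).trans_eq 
      (dist_eq_norm (E := StrongDual ℝ (StrongDual ℝ X)) _ _)
  generalize Metric.infDist Z (Set.range (NormedSpace.inclusionInDoubleDual ℝ X)) = d at hd hle
  choose f hf hf0 hfd using fun n : ℕ => exists_dual_vanishing_of_le_norm_sub hd hle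
    fun i : Fin n => TopologicalSpace.denseSeq X i
  choose x hx hxf using fun n : ℕ => exists_norm_le_forall_lt_apply Z
    (fun i : Fin (n + 1) => f i) (ε := d / 4) (by positivity)
  refine ⟨f, x, d / 4, ‖Z‖ + 1, hf, weakStarNull_of_forall_denseSeq hf
    fun n i hi => hf0 n ⟨i, hi⟩, by positivity, hx, fun i n hin => ?_⟩
  have h1 := hxf n ⟨i, Nat.lt_succ_of_le hin⟩
  have h2 := hfd i
  dsimp only at h1
  linarith

theorem PropertyM.isReflexive_of_not_embedsIso [CompleteSpace X]
    [TopologicalSpace.SeparableSpace X] (hM : PropertyM X)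
    (hl : ¬ EmbedsIso (lp (fun _ : ℕ => ℝ) 1) X) (hc : ¬ EmbedsIso C₀(ℕ, ℝ) X) :
    IsReflexive X := by
  by_contra h
  obtain ⟨f, x, d, R, hf, hf0, hd, hx, hfx⟩ :=
    exists_weakStarNull_and_bounded_of_not_isReflexive h
  obtain ⟨φ, hφ, hcau⟩ := exists_weaklyCauchy_subseq hx hl
  exact hc (hM.embedsIso_c0_of_weaklyCauchy hl (fun n => hx (φ n)) hcau hf hf0 hd
    fun i n hin => hfx i (φ n) (hin.trans hφ.le_apply))

end Bidual

section ReflexiveSubspace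

/-- In a space which embeds into a reflexive space, a bounded sequence has a point compatible with
all its limits against functionals. -/
theorem EmbedsIso.exists_forall_apply_eq_of_tendsto {F X : Type*} [NormedAddCommGroup F]
    [NormedSpace ℝ F] [CompleteSpace F] [NormedAddCommGroup X] [NormedSpace ℝ X]
    (h : EmbedsIso F X) (hX : IsReflexive X) {z : ℕ → F} {R : ℝ} (hz : ∀ n, ‖z n‖ ≤ R) :
    ∃ a : F, ∀ (g : F →L[ℝ] ℝ) (l : ℝ), Tendsto (fun n => g (z n)) atTop (𝓝 l) → g a = l := by
  obtain ⟨T, hTi, c, hc, hT⟩ := h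
  have hclosed : IsClosed (Set.range T) := by
    refine AntilipschitzWith.isClosed_range (T.antilipschitz_of_bound
      (K := Real.toNNReal c⁻¹) fun y => ?_) T.uniformContinuous
    rw [Real.coe_toNNReal _ (inv_pos.2 hc).le, le_inv_mul_iff₀ hc]
    exact hT y
  let J : ℕ → WeakDual ℝ (X →L[ℝ] ℝ) := fun n =>
    StrongDual.toWeakDual (NormedSpace.inclusionInDoubleDual ℝ X (T (z n)))
  have hJ : ∀ n, J n ∈ WeakDual.toStrongDual ⁻¹'
      Metric.closedBall (0 : StrongDual ℝ (X →L[ℝ] ℝ)) (‖T‖ * R) := by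
    intro n
    have h1 : ‖NormedSpace.inclusionInDoubleDual ℝ X (T (z n))‖ ≤ ‖T‖ * R :=
      (NormedSpace.double_dual_bound ℝ X _).trans (T.le_opNorm_of_le (hz n))
    exact (mem_closedBall_zero_iff (E := StrongDual ℝ (X →L[ℝ] ℝ))).2 h1
  obtain ⟨Λ, -, hΛ⟩ := (WeakDual.isCompact_closedBall (𝕜 := ℝ)
    (0 : StrongDual ℝ (X →L[ℝ] ℝ)) (‖T‖ * R)).ultrafilter_le_nhds ((hyperfilter ℕ).map J)
      (by
        rw [le_principal_iff]
        exact mem_map.2 (Eventually.of_forall hJ))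
  obtain ⟨x, hx⟩ := hX (WeakDual.toStrongDual Λ)
  have hlim : ∀ g : X →L[ℝ] ℝ, Tendsto (fun n => g (T (z n))) (hyperfilter ℕ) (𝓝 (g x)) := by
    intro g
    have h1 : Tendsto J (hyperfilter ℕ) (𝓝 Λ) := hΛ
    have h2 := ((WeakDual.eval_continuous g).tendsto Λ).comp h1
    have h3 : g x = Λ g := by
      rw [← NormedSpace.dual_def ℝ X x g, hx]
      rfl
    rw [h3]
    exact h2
  have hxT : x ∈ Set.range T := by
    by_contra hnot
    have hconv : Convex ℝ (Set.range T) := by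
      rw [← Set.image_univ]
      exact convex_univ.linear_image T.toLinearMap
    obtain ⟨g, u, hu, hux⟩ := geometric_hahn_banach_closed_point hconv hclosed hnot
    exact hux.not_ge (le_of_tendsto' (hlim g) fun n => (hu _ ⟨z n, rfl⟩).le)
  obtain ⟨a, rfl⟩ := hxT
  refine ⟨a, fun g l hl => ?_⟩
  let e := LinearEquiv.ofInjective T.toLinearMap hTi
  have he : ∀ y : F, e.symm ⟨T y, y, rfl⟩ = y := fun y => e.symm_apply_apply y
  let g' : StrongDual ℝ T.toLinearMap.range :=
    (g.toLinearMap.comp e.symm.toLinearMap).mkContinuous (‖g‖ * c⁻¹) (by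
      rintro ⟨_, y, rfl⟩
      change ‖g (e.symm ⟨T y, y, rfl⟩)‖ ≤ ‖g‖ * c⁻¹ * ‖T y‖
      rw [he, mul_assoc]
      exact g.le_opNorm_of_le ((le_inv_mul_iff₀ hc).2 (hT y)))
  obtain ⟨G, hG, -⟩ := exists_extension_norm_eq _ g'
  have hGT : ∀ y, G (T y) = g y := by
    intro y
    have h1 := hG ⟨T y, y, rfl⟩
    have h2 : g' ⟨T y, y, rfl⟩ = g (e.symm ⟨T y, y, rfl⟩) := rfl
    rw [h2, he] at h1
    exact h1
  have h1 := hlim G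
  simp only [hGT] at h1
  exact tendsto_nhds_unique h1 (hl.mono_left Nat.hyperfilter_le_atTop)

variable {X : Type*} [NormedAddCommGroup X] [NormedSpace ℝ X]

theorem IsReflexive.not_embedsIso_ell1 (hX : IsReflexive X) :
    ¬ EmbedsIso (lp (fun _ : ℕ => ℝ) 1) X := by
  intro h
  obtain ⟨a, ha⟩ := h.exists_forall_apply_eq_of_tendsto hX
    (z := fun n => lp.single 1 n (1 : ℝ)) (R := 1) (fun n => by simp [lp.norm_single])
  have ha0 : ∀ k, a k = 0 := by
    intro k
    refine ha (lp.evalCLM ℝ (fun _ : ℕ => ℝ) 1 k) 0 (tendsto_const_nhds.congr' ?_)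
    filter_upwards [eventually_gt_atTop k] with n hn
    change (0 : ℝ) = lp.single (E := fun _ : ℕ => ℝ) 1 n (1 : ℝ) k
    rw [lp.single_apply, Pi.single_eq_of_ne hn.ne]
  have hnorm : ∀ b : lp (fun _ : ℕ => ℝ) 1, HasSum (fun i => ‖b i‖) ‖b‖ := by
    intro b
    simpa using lp.hasSum_norm (p := 1) (by simp) b
  have hs : ∀ b : lp (fun _ : ℕ => ℝ) 1, Summable (fun i => b i) := fun b =>
    (hnorm b).summable.of_norm
  let σ : lp (fun _ : ℕ => ℝ) 1 →L[ℝ] ℝ := LinearMap.mkContinuous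
    { toFun := fun b => ∑' i, b i
      map_add' := fun b c => (hs b).tsum_add (hs c)
      map_smul' := fun r b => (hs b).tsum_const_smul r } 1 (by
    intro b
    rw [one_mul]
    exact tsum_of_norm_bounded (hnorm b) fun i => le_rfl)
  have h1 : σ a = 1 := by
    refine ha σ 1 (tendsto_const_nhds.congr fun n => ?_)
    change (1 : ℝ) = ∑' i, lp.single (E := fun _ : ℕ => ℝ) 1 n (1 : ℝ) i
    rw [tsum_eq_single n fun i hi => by rw [lp.single_apply, Pi.single_eq_of_ne hi],
      lp.single_apply, Pi.single_eq_same]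
  have h2 : σ a = ∑' i, a i := rfl
  rw [h2] at h1
  simp [ha0] at h1

theorem IsReflexive.not_embedsIso_c0 (hX : IsReflexive X) : ¬ EmbedsIso C₀(ℕ, ℝ) X := by
  intro h
  let z : ℕ → C₀(ℕ, ℝ) := fun n =>
    { toFun := fun i => if i ≤ n then 1 else 0
      continuous_toFun := continuous_of_discreteTopology
      zero_at_infty' := by
        rw [Filter.cocompact_eq_cofinite, Nat.cofinite_eq_atTop]
        refine tendsto_const_nhds.congr' ?_
        filter_upwards [eventually_gt_atTop n] with i hi
        rw [if_neg hi.not_ge] }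
  have hz : ∀ n i, z n i = if i ≤ n then 1 else 0 := fun n i => rfl
  obtain ⟨a, ha⟩ := h.exists_forall_apply_eq_of_tendsto hX (z := z) (R := 1) (by
    intro n
    rw [← ZeroAtInftyContinuousMap.norm_toBCF_eq_norm]
    refine (BoundedContinuousFunction.norm_le zero_le_one).2 fun i => ?_
    change ‖z n i‖ ≤ 1
    rw [hz]
    split_ifs <;> simp)
  have ha1 : ∀ i, a i = 1 := by
    intro i
    let ev : C₀(ℕ, ℝ) →L[ℝ] ℝ := LinearMap.mkContinuous
      { toFun := fun b => b i
        map_add' := fun b c => rfl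
        map_smul' := fun r b => rfl } 1 (by
      intro b
      rw [one_mul, ← ZeroAtInftyContinuousMap.norm_toBCF_eq_norm]
      exact b.toBCF.norm_coe_le_norm i)
    refine ha ev 1 (tendsto_const_nhds.congr' ?_)
    filter_upwards [eventually_ge_atTop i] with n hn
    change (1 : ℝ) = z n i
    rw [hz, if_pos hn]
  have h0 := zero_at_infty a
  rw [Filter.cocompact_eq_cofinite, Nat.cofinite_eq_atTop] at h0
  exact zero_ne_one (tendsto_nhds_unique h0 (tendsto_const_nhds.congr fun i => (ha1 i).symm))

end ReflexiveSubspace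

theorem stmt18 (X : Type*) [NormedAddCommGroup X] [NormedSpace ℝ X] [CompleteSpace X]
    [TopologicalSpace.SeparableSpace X]
    (hM : PropertyM X) :
    IsReflexive X ↔ (¬ EmbedsIso (lp (fun _ : ℕ => ℝ) 1) X ∧ ¬ EmbedsIso C₀(ℕ, ℝ) X) := by
  exact ⟨fun h => ⟨h.not_embedsIso_ell1, h.not_embedsIso_c0⟩,
    fun h => hM.isReflexive_of_not_embedsIso h.1 h.2⟩
end
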